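/- arXiv:1504.04538 — 5 statements merged into one kernel-verified Lean document; each statement's English description precedes it below -/
import Mathlib

section
/- Let θ ∈ [0,1], λ ∈ [0,1), and k ∈ {1,…,n−1}. Let X, Y be k-dimensional linear subspaces of ℝⁿ and Z an (n−k)-dimensional linear subspace of ℝⁿ such that ∠(X,Y) ≤ θ and ∠(Y,Z^⊥) ≤ λ. Then for any x ∈ X and z ∈ Z with z − x ∈ Y, one has |z| ≤ (θ/(1−λ)) · |x|. -/
open Set Metric MeasureTheory Filter Topology
open scoped ENNReal NNReal

noncomputable section

/-- The orthogonal projection of `ℝⁿ` onto a subspace, as a map `ℝⁿ →L[ℝ] ℝⁿ`. -/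
def projOp {n : ℕ} (U : Submodule ℝ (EuclideanSpace ℝ (Fin n))) :
    EuclideanSpace ℝ (Fin n) →L[ℝ] EuclideanSpace ℝ (Fin n) :=
  U.subtypeL.comp (Submodule.orthogonalProjectionOnto U)

/-- The angle `∠(U,V) = ‖π_U − π_V‖` between two subspaces of `ℝⁿ`. -/
def angleSub {n : ℕ} (U V : Submodule ℝ (EuclideanSpace ℝ (Fin n))) : ℝ :=
  ‖projOp U - projOp V‖

/-- **Proposition 2.3**: if `∠(X,Y) ≤ θ` and `∠(Y,Z^⊥) ≤ λ < 1` for `k`-planes `X, Y` and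
an `(n−k)`-plane `Z`, then any `x ∈ X` and `z ∈ Z` with `z − x ∈ Y` satisfy
`|z| ≤ θ/(1−λ)·|x|`. -/
theorem angle_comparison_estimate (n k : ℕ) (hk : 1 ≤ k) (hkn : k ≤ n - 1)
    (θ lam : ℝ) (hθ0 : 0 ≤ θ) (hθ1 : θ ≤ 1) (hlam0 : 0 ≤ lam) (hlam1 : lam < 1)
    (X Y Z : Submodule ℝ (EuclideanSpace ℝ (Fin n)))
    (hX : Module.finrank ℝ X = k) (hY : Module.finrank ℝ Y = k)
    (hZ : Module.finrank ℝ Z = n - k)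
    (hXY : angleSub X Y ≤ θ) (hYZ : angleSub Y Zᗮ ≤ lam)
    (x z : EuclideanSpace ℝ (Fin n)) (hx : x ∈ X) (hz : z ∈ Z) (hzx : z - x ∈ Y) :
    ‖z‖ ≤ θ / (1 - lam) * ‖x‖ := by
  have hpx : projOp X x = x := by
    simp only [projOp, ContinuousLinearMap.comp_apply, Submodule.subtypeL_apply]
    exact Submodule.starProjection_eq_self_iff.mpr hx
  have hpy : projOp Y (z - x) = z - x := by
    simp only [projOp, ContinuousLinearMap.comp_apply, Submodule.subtypeL_apply]
    exact Submodule.starProjection_eq_self_iff.mpr hzx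
  have hpz : projOp Zᗮ z = 0 := by
    simp only [projOp, ContinuousLinearMap.comp_apply, Submodule.subtypeL_apply]
    exact (Submodule.starProjection_apply_eq_zero_iff Zᗮ).mpr
      (Submodule.le_orthogonal_orthogonal Z hz)
  have h1 : ‖(projOp X - projOp Y) x‖ ≤ θ * ‖x‖ :=
    ContinuousLinearMap.le_of_opNorm_le _ hXY x
  have h2 : ‖(projOp Y - projOp Zᗮ) z‖ ≤ lam * ‖z‖ :=
    ContinuousLinearMap.le_of_opNorm_le _ hYZ z
  have h3 : z = (projOp X - projOp Y) x + (projOp Y - projOp Zᗮ) z := by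
    rw [map_sub] at hpy
    rw [ContinuousLinearMap.sub_apply, ContinuousLinearMap.sub_apply, hpx, hpz, sub_zero]
    calc z = x + (z - x) := by abel
      _ = x + (projOp Y z - projOp Y x) := by rw [hpy]
      _ = _ := by abel
  have h4 : ‖z‖ ≤ θ * ‖x‖ + lam * ‖z‖ := by
    calc ‖z‖ = ‖(projOp X - projOp Y) x + (projOp Y - projOp Zᗮ) z‖ := by rw [← h3]
      _ ≤ _ := (norm_add_le _ _).trans (add_le_add h1 h2)
  rw [div_mul_eq_mul_div, le_div_iff₀ (by linarith)]
  linarith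
end
end

section
/- Fix integers 1 ≤ m < n, constants R, L, d > 0, α ∈ (0,1], and A ≥ 1. Let Σ₁, Σ₂ ∈ C^{1,α}_{m,n}(R,L,d) satisfy d_H(Σ₁,Σ₂) < min{ 2^{-6} A^{-2} R², L^{-2/α}, 1 }, and let x ∈ Σ₁ and y ∈ Σ₂ be points with |x − y| ≤ A · d_H(Σ₁,Σ₂). Then, with C_ang = L(1 + 16A²) + 2A, the tangent planes satisfy ∠(T_xΣ₁, T_yΣ₂) ≤ C_ang · d_H(Σ₁,Σ₂)^{α/2}. -/
open Set Metric MeasureTheory Filter Topology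
open scoped ENNReal NNReal

noncomputable section

/-- `T` is an `m`-dimensional tangent plane for `S` at `x`, over which `S ∩ B(x,R)` is the
graph of a `1`-Lipschitz `C¹` function `f` with `f(0) = 0`, `Df(0) = 0` and `α`-Hölder
derivative with constant `L`. -/
def IsGraphPatchAt (m n : ℕ) (R L α : ℝ) (S : Set (EuclideanSpace ℝ (Fin n)))
    (x : EuclideanSpace ℝ (Fin n)) (T : Submodule ℝ (EuclideanSpace ℝ (Fin n))) : Prop :=
  Module.finrank ℝ T = m ∧
  ∃ f : T → Tᗮ, ContDiff ℝ 1 f ∧ f 0 = 0 ∧ fderiv ℝ f 0 = 0 ∧ LipschitzWith 1 f ∧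
    (∀ ξ η : T, ‖fderiv ℝ f ξ - fderiv ℝ f η‖ ≤ L * ‖ξ - η‖ ^ α) ∧
    S ∩ Metric.ball x R
      = (Set.range fun ξ : T =>
          x + (ξ : EuclideanSpace ℝ (Fin n)) + (f ξ : EuclideanSpace ℝ (Fin n)))
        ∩ Metric.ball x R

/-- The class `C^{1,α}_{m,n}(R,L,d)`: nonempty compact subsets of the closed ball of radius
`d` admitting uniform `C^{1,α}` graph patches at scale `R` with Hölder constant `L`. -/
def InClassC1 (m n : ℕ) (R L d α : ℝ) (S : Set (EuclideanSpace ℝ (Fin n))) : Prop :=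
  S.Nonempty ∧ IsCompact S ∧ S ⊆ Metric.closedBall 0 d ∧
  ∀ x ∈ S, ∃ T : Submodule ℝ (EuclideanSpace ℝ (Fin n)), IsGraphPatchAt m n R L α S x T

/-- Second-order estimate for a graph function. -/
theorem graph_bound {E F : Type*} [NormedAddCommGroup E] [NormedSpace ℝ E]
    [NormedAddCommGroup F] [NormedSpace ℝ F] (f : E → F) (L α : ℝ) (hL : 0 < L) (hα : 0 < α)
    (hf : ContDiff ℝ 1 f) (h0 : f 0 = 0) (hd0 : fderiv ℝ f 0 = 0)
    (hh : ∀ ξ η : E, ‖fderiv ℝ f ξ - fderiv ℝ f η‖ ≤ L * ‖ξ - η‖ ^ α) (ξ : E) :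
    ‖f ξ‖ ≤ L * ‖ξ‖ ^ α * ‖ξ‖ := by
  have hdiff : Differentiable ℝ f := hf.differentiable (by norm_num)
  have key := (convex_closedBall (0 : E) ‖ξ‖).norm_image_sub_le_of_norm_fderiv_le
    (𝕜 := ℝ) (f := f) (C := L * ‖ξ‖ ^ α) (x := 0) (y := ξ)
    (fun z _ => hdiff z) (fun z hz => by
      have h1 := hh z 0
      rw [hd0, sub_zero, sub_zero] at h1
      have hz' : ‖z‖ ≤ ‖ξ‖ := by simpa using hz
      refine h1.trans ?_
      gcongr) (by simp) (by simp)
  simpa [h0] using key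

set_option maxHeartbeats 2000000 in
theorem one_side (m n : ℕ) (R L α A h t : ℝ) (hL : 0 < L)
    (hα : 0 < α) (hα1 : α ≤ 1) (hA : 1 ≤ A)
    (S₁ S₂ : Set (EuclideanSpace ℝ (Fin n)))
    (ht : 0 < t) (ht1 : t < 1) (htR : 8 * A * t < R) (hht : h < t ^ 2)
    (hS : ∀ p ∈ S₁, ∃ q ∈ S₂, dist p q < t ^ 2)
    (x y : EuclideanSpace ℝ (Fin n)) (hxy : dist x y ≤ A * h)
    (T₁ T₂ : Submodule ℝ (EuclideanSpace ℝ (Fin n)))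
    (hT₁ : IsGraphPatchAt m n R L α S₁ x T₁) (hT₂ : IsGraphPatchAt m n R L α S₂ y T₂)
    (v : EuclideanSpace ℝ (Fin n)) (hv : v ∈ T₁) :
    ‖v - T₂.starProjection v‖ ≤ (L * (1 + 16 * A ^ 2) + 2 * A) * t ^ α * ‖v‖ := by
  obtain ⟨-, f, hf, hf0, hfd, hfl, hfh, hfS⟩ := hT₁
  obtain ⟨-, g, hg, hg0, hgd, -, hgh, hgS⟩ := hT₂
  have htα : t ≤ t ^ α := by
    simpa using Real.rpow_le_rpow_of_exponent_ge ht ht1.le hα1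
  have main : ∀ ξ : T₁, ‖ξ‖ = t → ‖(ξ : EuclideanSpace ℝ (Fin n)) - T₂.starProjection ξ‖
      ≤ (L * (1 + 16 * A ^ 2) + 2 * A) * t ^ α * t := by
    intro ξ hξ
    have hfξ : ‖f ξ‖ ≤ L * t ^ α * t := by
      simpa [hξ] using graph_bound f L α hL hα hf hf0 hfd hfh ξ
    have hfξ' : ‖f ξ‖ ≤ t := by
      have := hfl.dist_le_mul ξ 0
      simpa [hf0, hξ, dist_zero_right] using this
    have hAt : t ≤ A * t := by nlinarith
    have ht2 : t ^ 2 ≤ t := by nlinarith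
    set p : EuclideanSpace ℝ (Fin n) := x + ξ + f ξ with hp
    have hpx : ‖p - x‖ ≤ 2 * t := by
      have : p - x = (ξ : EuclideanSpace ℝ (Fin n)) + f ξ := by rw [hp]; abel
      rw [this]
      refine (norm_add_le _ _).trans ?_
      simp only [Submodule.coe_norm] at *
      linarith
    have hpS : p ∈ S₁ := by
      have : p ∈ S₁ ∩ Metric.ball x R := by
        rw [hfS]
        refine ⟨⟨ξ, rfl⟩, ?_⟩
        rw [Metric.mem_ball, dist_eq_norm]
        linarith
      exact this.1
    obtain ⟨q, hq, hpq⟩ := hS p hpS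
    rw [dist_eq_norm] at hpq hxy
    have hxy' : ‖x - y‖ ≤ A * t ^ 2 := hxy.trans (by gcongr)
    have hqy : ‖q - y‖ ≤ 4 * A * t := by
      have : q - y = -(p - q) + (p - x) + (x - y) := by abel
      rw [this]
      have h1 := norm_add_le (-(p - q) + (p - x)) (x - y)
      have h2 := norm_add_le (-(p - q)) (p - x)
      rw [norm_neg] at h2
      have h3 : A * t ^ 2 ≤ A * t := by gcongr
      linarith
    have hqB : q ∈ S₂ ∩ Metric.ball y R := by
      refine ⟨hq, ?_⟩
      rw [Metric.mem_ball, dist_eq_norm]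
      linarith
    rw [hgS] at hqB
    obtain ⟨⟨ζ, hζ⟩, -⟩ := hqB
    simp only at hζ
    have hζP : T₂.starProjection (ζ : EuclideanSpace ℝ (Fin n)) = ζ :=
      Submodule.starProjection_eq_self_iff.2 ζ.2
    have hgP : T₂.starProjection (g ζ : EuclideanSpace ℝ (Fin n)) = 0 :=
      (Submodule.starProjection_apply_eq_zero_iff T₂).2 (g ζ).2
    have hζn : ‖ζ‖ ≤ 4 * A * t := by
      have e : T₂.starProjection (q - y) = ζ := by
        have : q - y = (ζ : EuclideanSpace ℝ (Fin n)) + g ζ := by rw [← hζ]; abel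
        rw [this, map_add, hζP, hgP, add_zero]
      have := T₂.norm_starProjection_apply_le (q - y)
      rw [e] at this
      rw [Submodule.coe_norm]
      linarith
    have hgζ : ‖g ζ‖ ≤ L * (16 * A ^ 2) * t ^ α * t := by
      have h1 := graph_bound g L α hL hα hg hg0 hgd hgh ζ
      have h2 : ‖ζ‖ ^ α ≤ 4 * A * t ^ α := by
        calc ‖ζ‖ ^ α ≤ (4 * A * t) ^ α := by gcongr
          _ = (4 * A) ^ α * t ^ α := Real.mul_rpow (by linarith) ht.le
          _ ≤ 4 * A * t ^ α := by
            gcongr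
            simpa using Real.rpow_le_rpow_of_exponent_le (x := 4 * A) (by linarith) hα1
      calc ‖g ζ‖ ≤ L * ‖ζ‖ ^ α * ‖ζ‖ := h1
        _ ≤ L * (4 * A * t ^ α) * (4 * A * t) := by gcongr
        _ = _ := by ring
    have hξζ : ‖(ξ : EuclideanSpace ℝ (Fin n)) - ζ‖
        ≤ (L * (1 + 16 * A ^ 2) + 2 * A) * t ^ α * t := by
      have : (ξ : EuclideanSpace ℝ (Fin n)) - ζ = (p - q) - (x - y) - f ξ + g ζ := by
        rw [hp, ← hζ]; abel
      rw [this]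
      have h1 := norm_add_le ((p - q) - (x - y) - f ξ) (g ζ : EuclideanSpace ℝ (Fin n))
      have h2 := norm_sub_le ((p - q) - (x - y)) (f ξ : EuclideanSpace ℝ (Fin n))
      have h3 := norm_sub_le (p - q) (x - y)
      have h4 : t * t ≤ t ^ α * t := by gcongr
      have h5 : (1 + A) * (t * t) ≤ 2 * A * (t ^ α * t) := by
        exact mul_le_mul (by linarith) h4 (by positivity) (by positivity)
      rw [Submodule.coe_norm] at hfξ hgζ
      have h6 : (L * (1 + 16 * A ^ 2) + 2 * A) * t ^ α * t
          = L * t ^ α * t + L * (16 * A ^ 2) * t ^ α * t + 2 * A * (t ^ α * t) := by ring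
      have h7 : (1 + A) * (t * t) = t ^ 2 + A * t ^ 2 := by ring
      linarith
    have e : (ξ : EuclideanSpace ℝ (Fin n)) - T₂.starProjection ξ
        = T₂ᗮ.starProjection (ξ - ζ) := by
      rw [Submodule.starProjection_orthogonal_val, map_sub, hζP]; abel
    rw [e]
    exact (Submodule.norm_starProjection_apply_le _ _).trans hξζ
  rcases eq_or_ne v 0 with rfl | hv0
  · simp
  have hvn : 0 < ‖v‖ := norm_pos_iff.2 hv0
  have hc : 0 < t / ‖v‖ := by positivity
  have := main ⟨(t / ‖v‖) • v, T₁.smul_mem _ hv⟩ (by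
    rw [Submodule.coe_norm]
    simp only [norm_smul, Real.norm_of_nonneg hc.le]
    field_simp)
  simp only [map_smul, ← smul_sub, norm_smul, Real.norm_of_nonneg hc.le] at this
  rw [div_mul_eq_mul_div, div_le_iff₀ hvn] at this
  refine le_of_mul_le_mul_left (a := t) ?_ ht
  linarith

theorem angle_le {n : ℕ} (U V : Submodule ℝ (EuclideanSpace ℝ (Fin n))) (c : ℝ) (hc : 0 ≤ c)
    (hU : ∀ v ∈ U, ‖v - V.starProjection v‖ ≤ c * ‖v‖)
    (hV : ∀ v ∈ V, ‖v - U.starProjection v‖ ≤ c * ‖v‖) :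
    ‖U.starProjection - V.starProjection‖ ≤ c := by
  refine ContinuousLinearMap.opNorm_le_bound _ hc fun w => ?_
  set a := U.starProjection w with ha
  set b := w - a with hb
  have haU : a ∈ U := Submodule.starProjection_apply_mem _ _
  have hbU : b ∈ Uᗮ := Submodule.sub_starProjection_mem_orthogonal _
  have h1 := hU a haU
  -- projection of `b` to `V`
  have h2 : ‖V.starProjection b‖ ≤ c * ‖b‖ := by
    set z := V.starProjection b with hz
    have hzV : z ∈ V := Submodule.starProjection_apply_mem _ _
    have h3 := hV z hzV
    have e1 : inner ℝ z z = inner ℝ z b := by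
      have : inner ℝ z (b - z) = 0 :=
        (Submodule.mem_orthogonal V _).1 (Submodule.sub_starProjection_mem_orthogonal b) z hzV
      rw [inner_sub_right] at this
      linarith
    have e2 : inner ℝ z b = inner ℝ (z - U.starProjection z) b := by
      have : inner ℝ (U.starProjection z) b = 0 :=
        (Submodule.mem_orthogonal U _).1 hbU _ (Submodule.starProjection_apply_mem _ _)
      rw [inner_sub_left, this, sub_zero]
    have e3 : ‖z‖ * ‖z‖ ≤ c * ‖z‖ * ‖b‖ := by
      rw [← real_inner_self_eq_norm_mul_norm, e1, e2]
      exact (real_inner_le_norm _ _).trans (by gcongr)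
    rcases eq_or_ne z 0 with h0 | h0
    · rw [h0, norm_zero]; positivity
    · have : 0 < ‖z‖ := norm_pos_iff.2 h0
      nlinarith
  have ew : (U.starProjection - V.starProjection) w
      = (a - V.starProjection a) - V.starProjection b := by
    have : w = a + b := by rw [hb]; abel
    rw [ContinuousLinearMap.sub_apply, ← ha]
    conv_lhs => rw [this]
    rw [map_add]; abel
  have o1 : inner ℝ (a - V.starProjection a) (V.starProjection b) = 0 :=
    (Submodule.mem_orthogonal' V _).1 (Submodule.sub_starProjection_mem_orthogonal a) _
      (Submodule.starProjection_apply_mem _ _)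
  have o2 : inner ℝ a b = 0 := (Submodule.mem_orthogonal U _).1 hbU _ haU
  have n1 := norm_sub_sq_real (a - V.starProjection a) (V.starProjection b)
  have n2 := norm_add_sq_real a b
  have : a + b = w := by rw [hb]; abel
  rw [this, o2] at n2
  rw [o1, ← ew] at n1
  refine abs_le_of_sq_le_sq' ?_ (by positivity) |>.2
  have s1 : ‖a - V.starProjection a‖ ^ 2 ≤ (c * ‖a‖) ^ 2 := by gcongr
  have s2 : ‖V.starProjection b‖ ^ 2 ≤ (c * ‖b‖) ^ 2 := by gcongr
  rw [n1, mul_pow, n2]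
  nlinarith

/-- **Proximity of tangent planes** (Lemma 3.1): if `Σ₁, Σ₂ ∈ C^{1,α}_{m,n}(R,L,d)` are
Hausdorff-close and `|x − y| ≤ A·d_H(Σ₁,Σ₂)` for `x ∈ Σ₁`, `y ∈ Σ₂`, then
`∠(T_xΣ₁, T_yΣ₂) ≤ C_ang d_H(Σ₁,Σ₂)^{α/2}` with `C_ang = L(1+16A²)+2A`. -/
theorem tangent_plane_proximity (m n : ℕ) (R L d α A : ℝ)
    (hm : 1 ≤ m) (hmn : m < n) (hR : 0 < R) (hL : 0 < L) (hd : 0 < d)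
    (hα : 0 < α) (hα1 : α ≤ 1) (hA : 1 ≤ A)
    (S₁ S₂ : Set (EuclideanSpace ℝ (Fin n)))
    (h₁ : InClassC1 m n R L d α S₁) (h₂ : InClassC1 m n R L d α S₂)
    (hdH : Metric.hausdorffDist S₁ S₂
      < min (min (R ^ 2 / (64 * A ^ 2)) (L ^ (-(2 / α)))) 1)
    (x y : EuclideanSpace ℝ (Fin n)) (hx : x ∈ S₁) (hy : y ∈ S₂)
    (hxy : dist x y ≤ A * Metric.hausdorffDist S₁ S₂)
    (T₁ T₂ : Submodule ℝ (EuclideanSpace ℝ (Fin n)))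
    (hT₁ : IsGraphPatchAt m n R L α S₁ x T₁) (hT₂ : IsGraphPatchAt m n R L α S₂ y T₂) :
    angleSub T₁ T₂ ≤ (L * (1 + 16 * A ^ 2) + 2 * A) * Metric.hausdorffDist S₁ S₂ ^ (α / 2) := by
  set h := Metric.hausdorffDist S₁ S₂ with hh
  have hh0 : 0 ≤ h := Metric.hausdorffDist_nonneg
  have hfin : Metric.hausdorffEDist S₁ S₂ ≠ ⊤ :=
    Metric.hausdorffEDist_ne_top_of_nonempty_of_bounded h₁.1 h₂.1
      h₁.2.1.isBounded h₂.2.1.isBounded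
  have hA0 : 0 < A := by linarith
  have hb1 : h < R ^ 2 / (64 * A ^ 2) :=
    hdH.trans_le ((min_le_left _ _).trans (min_le_left _ _))
  have hb2 : h < 1 := hdH.trans_le (min_le_right _ _)
  have hs1 : √h < 1 := by rw [Real.sqrt_lt' one_pos]; simpa using hb2
  have hs2 : √h < R / (8 * A) := by
    rw [Real.sqrt_lt' (by positivity)]
    convert hb1 using 1
    rw [div_pow]; ring
  have key : ∀ t ∈ Set.Ioo (√h) (min 1 (R / (8 * A))),
      angleSub T₁ T₂ ≤ (L * (1 + 16 * A ^ 2) + 2 * A) * t ^ α := by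
    rintro t ⟨hta, htb⟩
    have ht : 0 < t := (Real.sqrt_nonneg h).trans_lt hta
    have ht1 : t < 1 := htb.trans_le (min_le_left _ _)
    have htR : 8 * A * t < R := by
      have := htb.trans_le (min_le_right _ _)
      rw [lt_div_iff₀ (by positivity)] at this
      linarith
    have hht : h < t ^ 2 := (Real.sqrt_lt' ht).1 hta
    refine angle_le T₁ T₂ _ (by positivity) ?_ ?_
    · intro v hv
      exact one_side m n R L α A h t hL hα hα1 hA S₁ S₂ ht ht1 htR hht
        (fun p hp => Metric.exists_dist_lt_of_hausdorffDist_lt hp hht hfin)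
        x y hxy T₁ T₂ hT₁ hT₂ v hv
    · intro v hv
      refine one_side m n R L α A h t hL hα hα1 hA S₂ S₁ ht ht1 htR hht
        (fun p hp => ?_) y x (by rwa [dist_comm]) T₂ T₁ hT₂ hT₁ v hv
      obtain ⟨q, hq, hd⟩ := Metric.exists_dist_lt_of_hausdorffDist_lt' hp hht hfin
      exact ⟨q, hq, by rwa [dist_comm]⟩
  have hlim : Tendsto (fun t : ℝ => (L * (1 + 16 * A ^ 2) + 2 * A) * t ^ α) (𝓝[>] (√h))
      (𝓝 ((L * (1 + 16 * A ^ 2) + 2 * A) * (√h) ^ α)) := by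
    apply Tendsto.mono_left _ nhdsWithin_le_nhds
    exact ((Real.continuousAt_rpow_const _ _ (Or.inr hα.le)).const_mul _).tendsto
  have hpow : (√h) ^ α = h ^ (α / 2) := by
    rw [Real.sqrt_eq_rpow, ← Real.rpow_mul hh0]; congr 1; ring
  rw [← hpow]
  refine ge_of_tendsto hlim ?_
  filter_upwards [Ioo_mem_nhdsGT (lt_min hs1 hs2)] with t ht using key t ht
end
end

section
/- Let V be an m-dimensional linear subspace of ℝⁿ, α ∈ (0,1], ϑ ∈ (0, 1/100), L > 0, v ∈ V, r ∈ (0,∞], and let f : V → V^⊥ be a C¹ function that is 1-Lipschitz and satisfies ‖Df(x) − Df(y)‖ ≤ L|x−y|^α for all x, y ∈ V ∩ B(v,r) (where B(v,∞) = ℝⁿ). Then for every m-dimensional subspace U of ℝⁿ with ∠(U,V) ≤ ϑ there exists a C¹ function g : U → U^⊥ such that, with ω := π_U(v + f(v)): (a) graph(f) = graph(g); (b) ‖Dg(ξ) − Dg(η)‖ ≤ L(1+12ϑ)(1+3ϑ)^α/(1−4ϑ) · |ξ−η|^α for all ξ, η ∈ U ∩ B(ω, r/(1+3ϑ)); (c)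 g is Lipschitz with constant at most (1+2ϑ)/(1−2ϑ); (d) if f(0) = 0 then g(0) = 0; and (e) if f(0) = 0 and Df(0) = 0 then ‖Dg(0)‖² ≤ ϑ²/(1−ϑ²). -/
open Set Metric MeasureTheory Filter Topology
open scoped ENNReal NNReal

noncomputable section

/-- Comparison of the two orthogonal decompositions of one vector. -/
theorem gt_key {n : ℕ} {U V : Submodule ℝ (EuclideanSpace ℝ (Fin n))} {ϑ : ℝ}
    (hang : angleSub U V ≤ ϑ) (u : U) (w : Uᗮ) (d : V) (e : Vᗮ)
    (h : (u : EuclideanSpace ℝ (Fin n)) + w = d + e) :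
    ‖(u : EuclideanSpace ℝ (Fin n)) - d‖ ≤ ϑ * ‖(d : EuclideanSpace ℝ (Fin n)) + e‖ := by
  have h1 : projOp U ((d : EuclideanSpace ℝ (Fin n)) + e) = u := by
    rw [← h]
    simp [projOp, Submodule.orthogonalProjectionOnto_apply_of_mem_orthogonal w.2]
  have h2 : projOp V ((d : EuclideanSpace ℝ (Fin n)) + e) = d := by
    simp [projOp, Submodule.orthogonalProjectionOnto_apply_of_mem_orthogonal e.2]
  calc ‖(u : EuclideanSpace ℝ (Fin n)) - d‖
      = ‖(projOp U - projOp V) ((d : EuclideanSpace ℝ (Fin n)) + e)‖ := by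
        rw [sub_apply, h1, h2]
    _ ≤ ‖projOp U - projOp V‖ * ‖(d : EuclideanSpace ℝ (Fin n)) + e‖ :=
        ContinuousLinearMap.le_opNorm _ _
    _ ≤ _ := mul_le_mul_of_nonneg_right hang (norm_nonneg _)

theorem gt_bounds {n : ℕ} {U V : Submodule ℝ (EuclideanSpace ℝ (Fin n))} {ϑ : ℝ} (hϑ : 0 < ϑ)
    (hang : angleSub U V ≤ ϑ) (u : U) (w : Uᗮ) (d : V) (e : Vᗮ)
    (h : (u : EuclideanSpace ℝ (Fin n)) + w = d + e) (hed : ‖e‖ ≤ ‖d‖) :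
    (1 - 2 * ϑ) * ‖d‖ ≤ ‖u‖ ∧ ‖w‖ ≤ (1 + 2 * ϑ) * ‖d‖ := by
  have h1 := gt_key hang u w d e h
  have h2 := norm_add_le (d : EuclideanSpace ℝ (Fin n)) e
  have h3 : (w : EuclideanSpace ℝ (Fin n)) = e - (u - d) := by
    rw [eq_sub_iff_add_eq, ← sub_eq_iff_eq_add'.2 h.symm]; abel
  have h4 := norm_sub_le (e : EuclideanSpace ℝ (Fin n)) (u - d)
  rw [← h3] at h4
  have h5 := norm_sub_norm_le (d : EuclideanSpace ℝ (Fin n)) u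
  rw [norm_sub_rev] at h5
  simp only [Submodule.coe_norm] at *
  constructor <;> nlinarith

/-- The linear isomorphism attached to a bounded-below map between spaces of equal dimension. -/
theorem gt_equiv {n m : ℕ} {U V : Submodule ℝ (EuclideanSpace ℝ (Fin n))}
    (hV : Module.finrank ℝ V = m) (hU : Module.finrank ℝ U = m) {c : ℝ} (hc : 0 < c)
    (T : V →L[ℝ] U) (hT : ∀ a, c * ‖a‖ ≤ ‖T a‖) :
    ∃ e : V ≃L[ℝ] U, (e : V →L[ℝ] U) = T := by
  have hinj : Function.Injective (T : V →ₗ[ℝ] U) := by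
    rw [injective_iff_map_eq_zero]
    intro a ha
    have h1 := hT a
    have h2 : T a = 0 := ha
    rw [h2, norm_zero] at h1
    exact norm_le_zero_iff.1 (by nlinarith [norm_nonneg a])
  refine ⟨((T : V →ₗ[ℝ] U).linearEquivOfInjective hinj (hV.trans hU.symm)).toContinuousLinearEquiv,
    ?_⟩
  ext a
  simp

set_option maxHeartbeats 4000000 in
/-- **Graph tilting** (Lemma 3.2): a graph of a `1`-Lipschitz `C¹` function `f : V → V^⊥`
with locally `α`-Hölder derivative can be rewritten as a graph of a function
`g : U → U^⊥` over any `m`-plane `U` with `∠(U,V) ≤ ϑ < 1/100`, with quantitative control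
of the Hölder seminorm of `Dg`, of `lip(g)`, and of `Dg(0)`. -/
theorem graph_tilting (m n : ℕ) (hm : 1 ≤ m) (hmn : m < n)
    (V : Submodule ℝ (EuclideanSpace ℝ (Fin n))) (hV : Module.finrank ℝ V = m)
    (α ϑ L : ℝ) (hα : 0 < α) (hα1 : α ≤ 1) (hϑ0 : 0 < ϑ) (hϑ : ϑ < 1 / 100) (hL : 0 < L)
    (v : V) (r : ℝ≥0∞) (hr : 0 < r)
    (f : V → Vᗮ) (hf : ContDiff ℝ 1 f) (hlip : LipschitzWith 1 f)
    (hH : ∀ x y : V, edist x v < r → edist y v < r →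
      ‖fderiv ℝ f x - fderiv ℝ f y‖ ≤ L * ‖x - y‖ ^ α)
    (U : Submodule ℝ (EuclideanSpace ℝ (Fin n))) (hU : Module.finrank ℝ U = m)
    (hang : angleSub U V ≤ ϑ) :
    ∃ g : U → Uᗮ, ContDiff ℝ 1 g ∧
      (Set.range fun ξ : V => (ξ : EuclideanSpace ℝ (Fin n)) + (f ξ : EuclideanSpace ℝ (Fin n)))
        = (Set.range fun ξ : U =>
            (ξ : EuclideanSpace ℝ (Fin n)) + (g ξ : EuclideanSpace ℝ (Fin n))) ∧
      (∀ ξ η : U,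
        edist ξ (Submodule.orthogonalProjectionOnto U ((v : EuclideanSpace ℝ (Fin n)) + (f v : EuclideanSpace ℝ (Fin n))))
          < r / ENNReal.ofReal (1 + 3 * ϑ) →
        edist η (Submodule.orthogonalProjectionOnto U ((v : EuclideanSpace ℝ (Fin n)) + (f v : EuclideanSpace ℝ (Fin n))))
          < r / ENNReal.ofReal (1 + 3 * ϑ) →
        ‖fderiv ℝ g ξ - fderiv ℝ g η‖
          ≤ (L * (1 + 12 * ϑ) * (1 + 3 * ϑ) ^ α / (1 - 4 * ϑ)) * ‖ξ - η‖ ^ α) ∧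
      LipschitzWith (Real.toNNReal ((1 + 2 * ϑ) / (1 - 2 * ϑ))) g ∧
      (f 0 = 0 → g 0 = 0) ∧
      (f 0 = 0 → fderiv ℝ f 0 = 0 → ‖fderiv ℝ g 0‖ ^ 2 ≤ ϑ ^ 2 / (1 - ϑ ^ 2)) := by
  set PU := Submodule.orthogonalProjectionOnto U with hPU
  set QU := Submodule.orthogonalProjectionOnto Uᗮ with hQU
  have hdec : ∀ z : EuclideanSpace ℝ (Fin n), (PU z : EuclideanSpace ℝ (Fin n)) + QU z = z := by
    intro z
    exact Submodule.starProjection_add_starProjection_orthogonal (K := U) z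
  have hc : 0 < 1 - 2 * ϑ := by linarith
  have hdist : ∀ x y : V, ‖f x - f y‖ ≤ ‖x - y‖ := by
    intro x y
    simpa using hlip.norm_sub_le x y
  have hDf : ∀ x a : V, ‖fderiv ℝ f x a‖ ≤ ‖a‖ := by
    intro x a
    have h1 := norm_fderiv_le_of_lipschitz ℝ hlip (x₀ := x)
    have h2 := (fderiv ℝ f x).le_opNorm a
    simp only [NNReal.coe_one] at h1
    nlinarith [norm_nonneg a]
  set F : V → EuclideanSpace ℝ (Fin n) := fun x => (x : EuclideanSpace ℝ (Fin n)) + f x with hF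
  have hFd : ∀ x, HasFDerivAt F (V.subtypeL + Vᗮ.subtypeL.comp (fderiv ℝ f x)) x := by
    intro x
    have h1 : HasFDerivAt f (fderiv ℝ f x) x :=
      (hf.differentiable (by norm_num) x).hasFDerivAt
    exact V.subtypeL.hasFDerivAt.add (Vᗮ.subtypeL.hasFDerivAt.comp x h1)
  have hFc : ContDiff ℝ 1 F :=
    V.subtypeL.contDiff.add (Vᗮ.subtypeL.contDiff.comp hf)
  have hFsub : ∀ x y : V, F x - F y = ((x - y : V) : EuclideanSpace ℝ (Fin n)) + (f x - f y : Vᗮ) := by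
    intro x y
    simp only [hF, Submodule.coe_sub]
    abel
  set p : V → U := fun x => PU (F x) with hp
  have hpc : ContDiff ℝ 1 p := PU.contDiff.comp hFc
  have hpd : ∀ x, HasFDerivAt p (PU.comp (V.subtypeL + Vᗮ.subtypeL.comp (fderiv ℝ f x))) x :=
    fun x => PU.hasFDerivAt.comp x (hFd x)
  have hpe : ∀ x, ∃ e : V ≃L[ℝ] U, (e : V →L[ℝ] U) =
      PU.comp (V.subtypeL + Vᗮ.subtypeL.comp (fderiv ℝ f x)) := by
    intro x
    refine gt_equiv hV hU hc _ fun a => ?_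
    exact (gt_bounds hϑ0 hang _ (QU _) a (fderiv ℝ f x a) (hdec _) (hDf x a)).1
  choose pe hpe using hpe
  have hlow0 : ∀ a : V, (1 - 2 * ϑ) * ‖a‖ ≤ ‖(PU.comp V.subtypeL) a‖ := by
    intro a
    refine (gt_bounds hϑ0 hang _ (QU a) a 0 ?_ (by simp)).1
    simpa using hdec a
  obtain ⟨e0, he0⟩ := gt_equiv hV hU hc (PU.comp V.subtypeL) hlow0
  obtain ⟨θ, hθ⟩ : ∃ θ : ℝ≥0, (θ : ℝ) = ϑ := ⟨⟨ϑ, hϑ0.le⟩, rfl⟩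
  have happ : ApproximatesLinearOn p (e0 : V →L[ℝ] U) univ θ := by
    intro x _ y _
    have h1 : p x - p y - (e0 : V →L[ℝ] U) (x - y) = PU ((f x - f y : Vᗮ) : EuclideanSpace ℝ (Fin n)) := by
      rw [he0]
      have : p x - p y = PU (F x - F y) := (map_sub PU _ _).symm
      rw [this, hFsub, map_add]
      simp
    rw [h1, hθ]
    have h2 := gt_key hang (PU ((f x - f y : Vᗮ) : EuclideanSpace ℝ (Fin n))) (QU _) (0 : V) (f x - f y)
      (by rw [hdec]; simp)
    have h3 := hdist x y
    simp only [Submodule.coe_zero, sub_zero, zero_add] at h2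
    exact h2.trans (mul_le_mul_of_nonneg_left h3 hϑ0.le)
  have hsmall : Subsingleton V ∨
      θ < ‖(e0.symm : U →L[ℝ] V)‖₊⁻¹ := by
    rcases e0.subsingleton_or_nnnorm_symm_pos with h | h
    · exact Or.inl h
    · right
      rw [← NNReal.coe_lt_coe, hθ]
      have h' : 0 < ‖(e0.symm : U →L[ℝ] V)‖ := h
      change ϑ < ‖(e0.symm : U →L[ℝ] V)‖⁻¹
      have h3 : ‖(e0.symm : U →L[ℝ] V)‖ ≤ (1 - 2 * ϑ)⁻¹ := by
        refine ContinuousLinearMap.opNorm_le_bound _ (by positivity) fun u => ?_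
        have h4 := hlow0 (e0.symm u)
        rw [← he0] at h4
        simp only [ContinuousLinearEquiv.coe_coe, ContinuousLinearEquiv.apply_symm_apply] at h4 ⊢
        rw [inv_mul_eq_div, le_div_iff₀ hc]
        linarith
      calc ϑ < 1 - 2 * ϑ := by linarith
        _ = ((1 - 2 * ϑ)⁻¹)⁻¹ := (inv_inv _).symm
        _ ≤ _ := inv_anti₀ h' h3
  set H := happ.toHomeomorph p hsmall with hH'
  have hHp : ∀ x, H x = p x := fun x => rfl
  set q : U → V := fun ξ => H.symm ξ with hq
  have hpq : ∀ ξ, p (q ξ) = ξ := fun ξ => H.apply_symm_apply ξ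
  have hqp : ∀ x, q (p x) = x := fun x => H.symm_apply_apply x
  have hqc : ContDiff ℝ 1 q :=
    H.contDiff_symm (f₀' := pe) (fun a => by rw [hpe]; exact hpd a) hpc
  set g : U → Uᗮ := fun ξ => QU (F (q ξ)) with hg
  have hgc : ContDiff ℝ 1 g := QU.contDiff.comp (hFc.comp hqc)
  have hgF : ∀ ξ : U, (ξ : EuclideanSpace ℝ (Fin n)) + g ξ = F (q ξ) := by
    intro ξ
    have := hdec (F (q ξ))
    have h2 : PU (F (q ξ)) = ξ := hpq ξ
    rw [h2] at this
    exact this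
  have hgd : ∀ ξ u : U, (u : EuclideanSpace ℝ (Fin n)) + fderiv ℝ g ξ u
      = (fderiv ℝ q ξ u : V) + (fderiv ℝ f (q ξ) (fderiv ℝ q ξ u) : Vᗮ) := by
    intro ξ u
    have h1 : HasFDerivAt (fun ξ : U => (ξ : EuclideanSpace ℝ (Fin n)) + g ξ)
        (U.subtypeL + Uᗮ.subtypeL.comp (fderiv ℝ g ξ)) ξ :=
      U.subtypeL.hasFDerivAt.add (Uᗮ.subtypeL.hasFDerivAt.comp ξ
        (hgc.differentiable (by norm_num) ξ).hasFDerivAt)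
    have h2 : HasFDerivAt (fun ξ : U => F (q ξ)) _ ξ := (hFd (q ξ)).comp ξ
        (hqc.differentiable (by norm_num) ξ).hasFDerivAt
    rw [← funext hgF] at h2
    have h3 := congrArg (fun T => T u) (h1.unique h2)
    simpa using h3
  have hsub : ∀ ξ η : U, ((ξ - η : U) : EuclideanSpace ℝ (Fin n)) + (g ξ - g η : Uᗮ)
      = (q ξ - q η : V) + (f (q ξ) - f (q η) : Vᗮ) := by
    intro ξ η
    rw [← hFsub, ← hgF, ← hgF, Submodule.coe_sub, Submodule.coe_sub]
    abel
  have hB : ∀ ξ η : U, (1 - 2 * ϑ) * ‖q ξ - q η‖ ≤ ‖ξ - η‖ ∧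
      ‖g ξ - g η‖ ≤ (1 + 2 * ϑ) * ‖q ξ - q η‖ := fun ξ η =>
    gt_bounds hϑ0 hang _ _ _ _ (hsub ξ η) (hdist _ _)
  have hq3 : ∀ ξ η : U, ‖q ξ - q η‖ ≤ (1 + 3 * ϑ) * ‖ξ - η‖ := by
    intro ξ η
    have h1 := (hB ξ η).1
    have h2 : 1 ≤ (1 + 3 * ϑ) * (1 - 2 * ϑ) := by nlinarith
    have h3 := mul_le_mul_of_nonneg_left h1 (by linarith : (0:ℝ) ≤ 1 + 3 * ϑ)
    have h4 := mul_le_mul_of_nonneg_right h2 (norm_nonneg (q ξ - q η))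
    linarith
  have hball : ∀ ξ : U, edist ξ (PU ((v : EuclideanSpace ℝ (Fin n)) + f v))
      < r / ENNReal.ofReal (1 + 3 * ϑ) → edist (q ξ) v < r := by
    intro ξ h
    have h0 : q (PU ((v : EuclideanSpace ℝ (Fin n)) + f v)) = v := hqp v
    have h1 := hq3 ξ (PU ((v : EuclideanSpace ℝ (Fin n)) + f v))
    rw [h0] at h1
    have h2 : edist (q ξ) v ≤ edist ξ (PU ((v : EuclideanSpace ℝ (Fin n)) + f v)) *
        ENNReal.ofReal (1 + 3 * ϑ) := by
      rw [edist_dist, edist_dist, ← ENNReal.ofReal_mul dist_nonneg]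
      apply ENNReal.ofReal_le_ofReal
      rw [dist_eq_norm, dist_eq_norm, mul_comm]
      exact h1
    refine h2.trans_lt ?_
    exact ENNReal.mul_lt_of_lt_div h
  refine ⟨g, hgc, ?_, ?_, ?_, ?_, ?_⟩
  · ext z
    constructor
    · rintro ⟨x, rfl⟩
      refine ⟨p x, ?_⟩
      simp only []
      rw [hgF, hqp]
    · rintro ⟨ξ, rfl⟩
      exact ⟨q ξ, (hgF ξ).symm⟩
  · intro ξ η hξ hη
    have hA := hH (q ξ) (q η) (hball ξ hξ) (hball η hη)
    set D := ‖fderiv ℝ f (q ξ) - fderiv ℝ f (q η)‖ with hD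
    have hD0 : 0 ≤ D := ContinuousLinearMap.opNorm_nonneg _
    have h4 : 0 < 1 - 4 * ϑ := by linarith
    have hmain : ‖fderiv ℝ g ξ - fderiv ℝ g η‖ ≤ D / (1 - 4 * ϑ) := by
      refine ContinuousLinearMap.opNorm_le_bound _ (by positivity) fun u => ?_
      have ha := hgd ξ u
      have hb := hgd η u
      have hna := (gt_bounds hϑ0 hang _ _ _ _ ha (hDf _ _)).1
      set a := fderiv ℝ q ξ u
      set b := fderiv ℝ q η u
      have hw : ((0 : U) : EuclideanSpace ℝ (Fin n)) + (fderiv ℝ g ξ u - fderiv ℝ g η u : Uᗮ)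
          = (a - b : V) + (fderiv ℝ f (q ξ) a - fderiv ℝ f (q η) b : Vᗮ) := by
        have h5 := congrArg₂ (fun s t => s - t) ha hb
        simp only [Submodule.coe_sub, Submodule.coe_zero] at h5 ⊢
        rw [add_sub_add_left_eq_sub, add_sub_add_comm] at h5
        rw [zero_add, h5]
      have hk := gt_key hang _ _ _ _ hw
      rw [← hw] at hk
      simp only [Submodule.coe_zero, zero_add, zero_sub, norm_neg] at hk
      have hE : fderiv ℝ f (q ξ) a - fderiv ℝ f (q η) b =
          (fderiv ℝ f (q ξ) - fderiv ℝ f (q η)) a + fderiv ℝ f (q η) (a - b) := by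
        simp [map_sub]
      have h6 : ‖fderiv ℝ f (q ξ) a - fderiv ℝ f (q η) b‖ ≤ D * ‖a‖ + ‖a - b‖ := by
        rw [hE]
        refine (norm_add_le _ _).trans (add_le_add ?_ (hDf _ _))
        exact ContinuousLinearMap.le_opNorm _ _
      have h7 : ‖fderiv ℝ g ξ u - fderiv ℝ g η u‖ ≤
          ‖a - b‖ + ‖fderiv ℝ f (q ξ) a - fderiv ℝ f (q η) b‖ := by
        have := norm_add_le ((a - b : V) : EuclideanSpace ℝ (Fin n))
          ((fderiv ℝ f (q ξ) a - fderiv ℝ f (q η) b : Vᗮ) : EuclideanSpace ℝ (Fin n))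
        rw [← hw, Submodule.coe_zero, zero_add] at this
        exact this
      have hk' : ‖a - b‖ ≤ ϑ * ‖fderiv ℝ g ξ u - fderiv ℝ g η u‖ := hk
      rw [sub_apply]
      set W := ‖fderiv ℝ g ξ u - fderiv ℝ g η u‖
      have h8 : (1 - 2 * ϑ) * W ≤ D * ‖a‖ := by linarith
      have h9 : (1 - 2 * ϑ) * ((1 - 2 * ϑ) * W) ≤ D * ‖u‖ := by
        calc (1 - 2 * ϑ) * ((1 - 2 * ϑ) * W) ≤ (1 - 2 * ϑ) * (D * ‖a‖) :=
              mul_le_mul_of_nonneg_left h8 hc.le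
          _ = D * ((1 - 2 * ϑ) * ‖a‖) := by ring
          _ ≤ _ := mul_le_mul_of_nonneg_left hna hD0
      have hW : 0 ≤ W := norm_nonneg _
      rw [div_mul_eq_mul_div, le_div_iff₀ h4]
      nlinarith [mul_nonneg (sq_nonneg ϑ) hW]
    have hpow : ‖q ξ - q η‖ ^ α ≤ (1 + 3 * ϑ) ^ α * ‖ξ - η‖ ^ α := by
      rw [← Real.mul_rpow (by linarith) (norm_nonneg _)]
      exact Real.rpow_le_rpow (norm_nonneg _) (hq3 ξ η) hα.le
    have hX : 0 ≤ (1 + 3 * ϑ) ^ α * ‖ξ - η‖ ^ α := by positivity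
    refine hmain.trans ?_
    rw [div_mul_eq_mul_div]
    refine div_le_div_of_nonneg_right ?_ h4.le
    have h10 : D ≤ L * ((1 + 3 * ϑ) ^ α * ‖ξ - η‖ ^ α) :=
      hA.trans (mul_le_mul_of_nonneg_left hpow hL.le)
    have h11 : 0 ≤ 12 * ϑ * (L * ((1 + 3 * ϑ) ^ α * ‖ξ - η‖ ^ α)) := by positivity
    linarith
  · refine LipschitzWith.of_dist_le_mul fun ξ η => ?_
    rw [Real.coe_toNNReal _ (by positivity), dist_eq_norm, dist_eq_norm]
    obtain ⟨h1, h2⟩ := hB ξ η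
    rw [div_mul_eq_mul_div, le_div_iff₀ hc]
    have h3 := mul_le_mul_of_nonneg_left h1 (by linarith : (0:ℝ) ≤ 1 + 2 * ϑ)
    have h5 := mul_le_mul_of_nonneg_right h2 hc.le
    linarith
  · intro h0
    have hF0 : F 0 = 0 := by simp [hF, h0]
    have hp0 : p 0 = 0 := by simp [hp, hF0]
    have hq0 : q 0 = 0 := by rw [← hp0, hqp]
    simp [hg, hq0, hF0]
  · intro h0 h1
    have hF0 : F 0 = 0 := by simp [hF, h0]
    have hp0 : p 0 = 0 := by simp [hp, hF0]
    have hq0 : q 0 = 0 := by rw [← hp0, hqp]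
    have h2 : 0 < 1 - ϑ ^ 2 := by nlinarith
    have hs : ‖fderiv ℝ g 0‖ ≤ √(ϑ ^ 2 / (1 - ϑ ^ 2)) := by
      refine ContinuousLinearMap.opNorm_le_bound _ (Real.sqrt_nonneg _) fun u => ?_
      have ha := hgd 0 u
      rw [hq0, h1] at ha
      have hk := gt_key hang _ _ _ _ ha
      rw [← ha] at hk
      simp only [zero_apply, Submodule.coe_zero, add_zero] at ha
      rw [← ha, sub_add_cancel_left, norm_neg] at hk
      have hpy := norm_add_sq_eq_norm_sq_add_norm_sq_of_inner_eq_zero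
        (u : EuclideanSpace ℝ (Fin n)) (fderiv ℝ g 0 u : Uᗮ)
        (Submodule.inner_right_of_mem_orthogonal u.2 (fderiv ℝ g 0 u).2)
      simp only [Submodule.coe_norm] at *
      have hk2 := mul_self_le_mul_self (norm_nonneg _) hk
      rw [← Real.sqrt_sq (norm_nonneg (u : EuclideanSpace ℝ (Fin n))),
        ← Real.sqrt_mul (by positivity)]
      apply Real.le_sqrt_of_sq_le
      rw [div_mul_eq_mul_div, le_div_iff₀ h2]
      nlinarith
    calc ‖fderiv ℝ g 0‖ ^ 2 ≤ √(ϑ ^ 2 / (1 - ϑ ^ 2)) ^ 2 :=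
          pow_le_pow_left₀ (ContinuousLinearMap.opNorm_nonneg _) hs 2
      _ = _ := Real.sq_sqrt (by positivity)
end
end

section
/- Fix integers 1 ≤ m < n, constants L, R, d > 0 and α ∈ (0,1], and let Σ ∈ C^{1,α}_{m,n}(R,L,d). Then there exists a constant C ≥ 1 depending only on L, R, α, m, n such that for every ε ∈ (0,1] there exists an ε-normal map Φ : Σ → Hom(ℝⁿ,ℝⁿ) for Σ whose Lipschitz constant satisfies lip(Φ) ≤ C · ε^{-1/α}. -/
open Set Metric MeasureTheory Filter Topology
open scoped ENNReal NNReal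

noncomputable section

/-- An `ε`-normal map for `S ∈ C^{1,α}_{m,n}(R,L,·)` with Lipschitz constant `K`:
a `C¹` (on a neighbourhood of `S`) Lipschitz map into the orthogonal projections onto
`(n−m)`-dimensional subspaces, `ε`-close at each `x ∈ S` to the orthogonal projection
onto the normal space `(T_xS)^⊥`. -/
def IsNormalMap (m n : ℕ) (R L α ε : ℝ) (S : Set (EuclideanSpace ℝ (Fin n)))
    (Φ : EuclideanSpace ℝ (Fin n) → (EuclideanSpace ℝ (Fin n) →L[ℝ] EuclideanSpace ℝ (Fin n)))
    (K : ℝ≥0) : Prop :=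
  (∃ U : Set (EuclideanSpace ℝ (Fin n)), IsOpen U ∧ S ⊆ U ∧ ContDiffOn ℝ 1 Φ U) ∧
  LipschitzOnWith K Φ S ∧
  (∀ x ∈ S, ∃ W : Submodule ℝ (EuclideanSpace ℝ (Fin n)),
    Module.finrank ℝ W = n - m ∧ Φ x = projOp W) ∧
  (∀ x ∈ S, ∀ T : Submodule ℝ (EuclideanSpace ℝ (Fin n)),
    IsGraphPatchAt m n R L α S x T → ‖Φ x - projOp Tᗮ‖ ≤ ε)


lemma sqc_bound (k : ℕ) : 0 ≤ Ring.multichoose (1/2 : ℝ) k ∧ Ring.multichoose (1/2 : ℝ) k ≤ 1 := by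
  have h : ∀ k : ℕ, (k.factorial : ℝ) * Ring.multichoose (1/2 : ℝ) k = (ascPochhammer ℝ k).eval (1/2) := by
    intro k
    have := Ring.factorial_nsmul_multichoose_eq_ascPochhammer (1/2 : ℝ) k
    rw [← Polynomial.ascPochhammer_smeval_eq_eval] 
    rw [← this]; simp
  induction k with
  | zero => simp
  | succ k ih =>
    have h1 := h (k+1)
    rw [ascPochhammer_succ_eval, ← h k, Nat.factorial_succ] at h1
    push_cast at h1
    have hk : (0:ℝ) < k.factorial := by positivity
    have h2 : ((k:ℝ)+1) * Ring.multichoose (1/2 : ℝ) (k+1) = Ring.multichoose (1/2 : ℝ) k * (1/2 + k) := by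
      apply mul_left_cancel₀ hk.ne'
      linarith
    have h3 : Ring.multichoose (1/2 : ℝ) (k+1) = Ring.multichoose (1/2 : ℝ) k * ((1/2 + k)/(k+1)) := by
      field_simp; field_simp at h2; linarith
    rw [h3]
    have h4 : (1/2 + (k:ℝ))/(k+1) ≤ 1 := by
      rw [div_le_one (by positivity)]; linarith
    exact ⟨by have := ih.1; positivity, mul_le_one₀ ih.2 (by positivity) h4⟩

lemma sqc_conv (k : ℕ) : ∑ ij ∈ Finset.HasAntidiagonal.antidiagonal k,
    Ring.multichoose (1/2 : ℝ) ij.1 * Ring.multichoose (1/2 : ℝ) ij.2 = 1 := by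
  have hm : ∀ (r : ℝ) j, Ring.multichoose r j = (-1)^j * Ring.choose (-r) j := by
    intro r j
    rw [Ring.choose_neg, Int.negOnePow_def, Ring.multichoose_eq, Units.smul_def]
    simp [← mul_assoc, ← mul_pow]
  have := Ring.add_choose_eq (r := (-(1/2) : ℝ)) (s := -(1/2)) k (Commute.all _ _)
  rw [show (-(1/2) : ℝ) + -(1/2) = -1 by norm_num] at this
  have h1 := hm 1 k
  rw [this, Ring.multichoose_one] at h1
  refine Eq.trans ?_ h1.symm
  rw [Finset.mul_sum]
  apply Finset.sum_congr rfl
  intro ij hij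
  rw [hm, hm, ← Finset.HasAntidiagonal.mem_antidiagonal.1 hij, pow_add]; ring

lemma exists_invsqrt (A : Type*) [NormedRing A] [NormOneClass A] [NormedAlgebra ℝ A] [CompleteSpace A] 
   [StarRing A] [ContinuousStar A] [StarModule ℝ A] :
   ∃ h : A → A, ContDiffOn ℝ 1 h (ball 0 1) ∧ h 0 = 1 ∧ ∀ Z, ‖Z‖ < 1 → 
    h Z * h Z * (1 - Z) = 1 ∧ (∀ B, Commute B Z → Commute B (h Z)) ∧ 
    (IsSelfAdjoint Z → IsSelfAdjoint (h Z)) := by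
  set c : ℕ → ℝ := fun k => Ring.multichoose (1/2 : ℝ) k with hc
  have habs : ∀ k, ‖c k‖ ≤ 1 := fun k => by
    rw [Real.norm_of_nonneg (sqc_bound k).1]; exact (sqc_bound k).2
  refine ⟨FormalMultilinearSeries.ofScalarsSum c, ?_, by simp [hc], ?_⟩
  · have hr : (1 : ENNReal) ≤ (FormalMultilinearSeries.ofScalars A c).radius := by
      refine FormalMultilinearSeries.le_radius_of_bound _ 1 (r := 1) fun n => ?_
      rw [FormalMultilinearSeries.ofScalars_norm]
      simpa using habs n
    have h1 := (FormalMultilinearSeries.ofScalars A c).hasFPowerSeriesOnBall (lt_of_lt_of_le one_pos hr)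
    have h2 := h1.analyticOnNhd.contDiffOn_of_completeSpace (n := 1)
    refine h2.mono ?_
    intro x hx
    rw [mem_eball]
    refine lt_of_lt_of_le ?_ hr
    rw [mem_ball, dist_zero_right] at hx
    simpa [edist_eq_enorm_sub, ← ofReal_norm] using hx
  · intro Z hZ
    have hs : Summable fun k => ‖c k • Z^k‖ := by
      refine Summable.of_nonneg_of_le (fun _ => norm_nonneg _) (fun k => ?_) (summable_geometric_of_lt_one (norm_nonneg Z) hZ)
      rw [norm_smul]
      calc _ ≤ 1 * ‖Z‖^k := by
            gcongr
            · exact habs k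
            · exact norm_pow_le _ _
        _ = _ := one_mul _
    rw [FormalMultilinearSeries.ofScalars_sum_eq]
    refine ⟨?_, ?_, ?_⟩
    · rw [tsum_mul_tsum_eq_tsum_sum_antidiagonal_of_summable_norm hs hs]
      have : ∀ k, ∑ kl ∈ Finset.HasAntidiagonal.antidiagonal k, c kl.1 • Z ^ kl.1 * c kl.2 • Z ^ kl.2 = Z^k := by
        intro k
        have : ∀ kl ∈ Finset.HasAntidiagonal.antidiagonal k, c kl.1 • Z ^ kl.1 * c kl.2 • Z ^ kl.2 = (c kl.1 * c kl.2) • Z^k := by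
          intro kl hkl
          rw [smul_mul_smul_comm, ← pow_add, Finset.HasAntidiagonal.mem_antidiagonal.1 hkl]
        rw [Finset.sum_congr rfl this, ← Finset.sum_smul, sqc_conv, one_smul]
      simp_rw [this]
      exact geom_series_mul_neg Z hZ
    · intro B hB
      exact Commute.tsum_right _ fun i => (hB.pow_right i).smul_right _
    · intro h
      rw [IsSelfAdjoint, tsum_star]
      congr 1; ext k
      rw [star_smul, star_pow, h.star_eq]; simp

lemma exists_retr (E : Type*) [NormedAddCommGroup E] [InnerProductSpace ℝ E]
    [FiniteDimensional ℝ E] [CompleteSpace E] [Nontrivial E] :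
    ∃ (G : (E →L[ℝ] E) → (E →L[ℝ] E)) (O : Set (E →L[ℝ] E)) (K : ℝ), 1 ≤ K ∧ IsOpen O ∧
      ContDiffOn ℝ 1 G O ∧
      (∀ P A, IsStarProjection P → ‖P‖ ≤ 1 → IsSelfAdjoint A → ‖A - P‖ ≤ 1/16 →
        A ∈ O ∧ IsStarProjection (G A) ∧ ‖G A - P‖ ≤ K * ‖A - P‖) ∧
      (∀ P A Q B, IsStarProjection P → ‖P‖ ≤ 1 → IsSelfAdjoint A → ‖A - P‖ ≤ 1/16 →
        IsStarProjection Q → ‖Q‖ ≤ 1 → IsSelfAdjoint B → ‖B - Q‖ ≤ 1/16 →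
        ‖G A - G B‖ ≤ K * ‖A - B‖) := by
  obtain ⟨h, hC, h0, hh⟩ := exists_invsqrt (E →L[ℝ] E)
  have hlip : ∃ k, LipschitzOnWith k h (closedBall 0 (1/2)) := by
    apply LocallyLipschitzOn.exists_lipschitzOnWith_of_compact (isCompact_closedBall _ _)
    apply ContDiffOn.locallyLipschitzOn (convex_closedBall _ _)
    exact hC.mono (closedBall_subset_ball (by norm_num))
  obtain ⟨k, hk⟩ := hlip
  have hk' : ∀ X Y : E →L[ℝ] E, ‖X‖ ≤ 1/2 → ‖Y‖ ≤ 1/2 → ‖h X - h Y‖ ≤ k * ‖X - Y‖ := by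
    intro X Y hX hY
    have := hk.dist_le_mul X (by simpa using hX) Y (by simpa using hY)
    simpa [dist_eq_norm] using this
  have hb : ∀ X : E →L[ℝ] E, ‖X‖ ≤ 1/2 → ‖h X‖ ≤ 1 + k := by
    intro X hX
    have h1 := hk' X 0 hX (by simp)
    rw [h0, sub_zero] at h1
    have h2 : ‖h X‖ ≤ ‖h X - 1‖ + ‖(1 : E →L[ℝ] E)‖ := by
      simpa using norm_add_le (h X - 1) 1
    rw [norm_one] at h2
    nlinarith [k.coe_nonneg]
  set H : (E →L[ℝ] E) → (E →L[ℝ] E) := fun A => (2:ℝ) • A - 1 with hH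
  set X : (E →L[ℝ] E) → (E →L[ℝ] E) := fun A => 1 - H A * H A with hX
  set G : (E →L[ℝ] E) → (E →L[ℝ] E) := fun A => (1/2 : ℝ) • (1 + H A * h (X A)) with hG
  have hHd : ∀ A B, ‖H A - H B‖ = 2 * ‖A - B‖ := by
    intro A B
    have : H A - H B = (2:ℝ) • (A - B) := by simp only [hH]; module
    rw [this, norm_smul]; norm_num
  have hHb : ∀ A, ‖A‖ ≤ 2 → ‖H A‖ ≤ 5 := by
    intro A hA
    have : ‖H A‖ ≤ ‖(2:ℝ) • A‖ + ‖(1 : E →L[ℝ] E)‖ := norm_sub_le _ _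
    rw [norm_one, norm_smul] at this
    norm_num at this
    linarith
  have hXd : ∀ A B, ‖X A - X B‖ ≤ 2 * ‖A - B‖ * (‖H A‖ + ‖H B‖) := by
    intro A B
    have : X A - X B = (H B - H A) * H B + H A * (H B - H A) := by
      simp only [hX]; noncomm_ring
    rw [this]
    refine (norm_add_le _ _).trans ?_
    have h1 := norm_mul_le (H B - H A) (H B)
    have h2 := norm_mul_le (H A) (H B - H A)
    have hd : ‖H B - H A‖ = 2 * ‖A - B‖ := by rw [hHd, norm_sub_rev]
    rw [hd] at h1 h2
    linarith
  have hGl : ∀ A B, ‖A‖ ≤ 2 → ‖X A‖ ≤ 1/2 → ‖B‖ ≤ 2 → ‖X B‖ ≤ 1/2 →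
      ‖G A - G B‖ ≤ (1 + 60 * k) * ‖A - B‖ := by
    intro A B hA hXA hB hXB
    have e : G A - G B = (1/2 : ℝ) • ((H A - H B) * h (X A) + H B * (h (X A) - h (X B))) := by
      simp only [hG]
      rw [← smul_sub]; congr 1; noncomm_ring
    have h1 : ‖(H A - H B) * h (X A)‖ ≤ 2 * ‖A - B‖ * (1 + k) := by
      refine (norm_mul_le _ _).trans ?_
      rw [hHd]; gcongr; exact hb _ hXA
    have h2 : ‖X A - X B‖ ≤ 20 * ‖A - B‖ := by
      have := hXd A B
      have h5 := hHb A hA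
      have h6 := hHb B hB
      nlinarith [norm_nonneg (A - B)]
    have h3 : ‖H B * (h (X A) - h (X B))‖ ≤ 5 * (k * (20 * ‖A - B‖)) := by
      refine (norm_mul_le _ _).trans ?_
      gcongr
      · exact hHb B hB
      · exact (hk' _ _ hXA hXB).trans (by gcongr)
    rw [e, norm_smul]
    have h4 := norm_add_le ((H A - H B) * h (X A)) (H B * (h (X A) - h (X B)))
    have : ‖(1/2:ℝ)‖ = 1/2 := by norm_num
    rw [this]
    have h7 : (0:ℝ) ≤ k * ‖A - B‖ := by positivity
    nlinarith
  have hPH : ∀ P : E →L[ℝ] E, IsStarProjection P → H P * H P = 1 := by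
    intro P hP
    have h1 : P * P = P := hP.isIdempotentElem
    simp only [hH, sub_mul, mul_sub, smul_mul_smul_comm, h1, one_mul, mul_one]
    module
  have hPX : ∀ P : E →L[ℝ] E, IsStarProjection P → X P = 0 := by
    intro P hP
    simp only [hX, hPH P hP, sub_self]
  have hPG : ∀ P : E →L[ℝ] E, IsStarProjection P → G P = P := by
    intro P hP
    simp only [hG, hPX P hP, h0, hH, mul_one]
    module
  have key : ∀ P A : E →L[ℝ] E, IsStarProjection P → ‖P‖ ≤ 1 → ‖A - P‖ ≤ 1/16 →
      ‖A‖ ≤ 2 ∧ ‖X A‖ ≤ 1/2 := by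
    intro P A hP hP1 hA
    have a1 : ‖A‖ ≤ ‖A - P‖ + ‖P‖ := by simpa using norm_add_le (A - P) P
    have a2 : ‖H P‖ ≤ 3 := by
      have : ‖H P‖ ≤ ‖(2:ℝ) • P‖ + ‖(1 : E →L[ℝ] E)‖ := norm_sub_le _ _
      rw [norm_one, norm_smul] at this
      norm_num at this
      linarith
    have a4 : ‖H P‖ ≤ 1 := by
      have hs : IsSelfAdjoint (H P) := by
        simp only [hH]
        exact (IsSelfAdjoint.smul (by simp) hP.isSelfAdjoint).sub (IsSelfAdjoint.one _)
      have := CStarRing.norm_star_mul_self (x := H P)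
      rw [hs.star_eq, hPH P hP, norm_one] at this
      nlinarith [norm_nonneg (H P)]
    have a3 : ‖H A‖ ≤ ‖H A - H P‖ + ‖H P‖ := by simpa using norm_add_le (H A - H P) (H P)
    rw [hHd] at a3
    refine ⟨by linarith, ?_⟩
    have := hXd A P
    rw [hPX P hP, sub_zero] at this
    nlinarith [norm_nonneg (A - P)]
  refine ⟨G, {A | ‖X A‖ < 1}, 1 + 60 * k, by simp, ?_, ?_, ?_, ?_⟩
  · have : Continuous X := by fun_prop
    exact isOpen_lt this.norm continuous_const
  · have c1 : ContDiff ℝ 1 H := by fun_prop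
    have c2 : ContDiff ℝ 1 X := by
      simp only [hX]
      exact contDiff_const.sub (c1.mul c1)
    have c3 : ContDiffOn ℝ 1 (fun A => h (X A)) {A | ‖X A‖ < 1} :=
      hC.comp c2.contDiffOn (fun A hA => by simpa using hA)
    exact (contDiffOn_const.add (c1.contDiffOn.mul c3)).const_smul _
  · intro P A hP hP1 hA hAP
    obtain ⟨k1, k2⟩ := key P A hP hP1 hAP
    have k3 : ‖X A‖ < 1 := by linarith
    refine ⟨k3, ?_, ?_⟩
    · obtain ⟨q1, q2, q3⟩ := hh (X A) k3
      have hs : IsSelfAdjoint (H A) := by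
        simp only [hH]
        exact (IsSelfAdjoint.smul (by simp) hA).sub (IsSelfAdjoint.one _)
      have hXs : IsSelfAdjoint (X A) := by
        simp only [hX]
        refine (IsSelfAdjoint.one _).sub ?_
        rw [IsSelfAdjoint, star_mul, hs.star_eq]
      have hc : Commute (H A) (h (X A)) := by
        apply q2
        simp only [hX]
        exact (Commute.one_right _).sub_right ((Commute.refl _).mul_right (Commute.refl _))
      have hS : (H A * h (X A)) * (H A * h (X A)) = 1 := by
        have e : H A * H A = 1 - X A := by simp [hX]
        calc _ = (h (X A) * H A) * (H A * h (X A)) := by rw [hc.eq]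
          _ = h (X A) * ((H A * H A) * h (X A)) := by noncomm_ring
          _ = h (X A) * (h (X A) * (H A * H A)) := by
              rw [((hc.mul_left hc)).eq]
          _ = _ := by rw [e, ← mul_assoc, q1]
      refine ⟨?_, ?_⟩
      · change G A * G A = G A
        simp only [hG, smul_mul_smul_comm, add_mul, mul_add, hS, one_mul, mul_one]
        module
      · simp only [hG]
        refine IsSelfAdjoint.smul (by simp) ((IsSelfAdjoint.one _).add ?_)
        rw [IsSelfAdjoint, star_mul, hs.star_eq, (q3 hXs).star_eq, hc.eq]
    · obtain ⟨k4, k5⟩ := key P P hP hP1 (by simp)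
      have := hGl A P k1 k2 k4 k5
      rwa [hPG P hP] at this
  · intro P A Q B hP hP1 hA hAP hQ hQ1 hB hBQ
    obtain ⟨k1, k2⟩ := key P A hP hP1 hAP
    obtain ⟨k3, k4⟩ := key Q B hQ hQ1 hBQ
    exact hGl A B k1 k2 k3 k4

lemma smooth_real {E : Type*} [NormedAddCommGroup E] [InnerProductSpace ℝ E]
    [FiniteDimensional ℝ E] [MeasurableSpace E] [BorelSpace E] (S : Set E) (f : E → ℝ)
    (M δ ε : ℝ) (hδ : 0 < δ) (hε : 0 < ε) (hM0 : 0 ≤ M) (hM : ∀ x ∈ S, |f x| ≤ M)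
    (hmod : ∀ x ∈ S, ∀ y ∈ S, dist x y < δ → |f x - f y| ≤ ε) :
    ∃ g : E → ℝ, ContDiff ℝ 1 g ∧ (∀ x y, |g x - g y| ≤ 2 * M / δ * dist x y) ∧
      ∀ x ∈ S, |g x - f x| ≤ 2 * ε := by
  rcases S.eq_empty_or_nonempty with rfl | hS
  · exact ⟨fun _ => 0, contDiff_const, fun x y => by simp; positivity, by simp⟩
  set K : ℝ := 2 * M / δ with hK
  have hK0 : 0 ≤ K := by positivity
  have : Nonempty S := hS.to_subtype
  set g0 : E → ℝ := fun y => ⨅ x : S, (f x + K * dist (x : E) y) with hg0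
  have hbdd : ∀ y, BddBelow (range fun x : S => f x + K * dist (x : E) y) := by
    intro y
    refine ⟨-M, ?_⟩
    rintro _ ⟨x, rfl⟩
    have h1 := (abs_le.1 (hM x x.2)).1
    have h2 : 0 ≤ K * dist (x : E) y := by positivity
    simp only
    linarith
  have hl1 : ∀ x y, g0 x ≤ g0 y + K * dist x y := by
    intro x y
    rw [← sub_le_iff_le_add]
    refine le_ciInf fun z => ?_
    rw [sub_le_iff_le_add]
    refine (ciInf_le (hbdd x) z).trans ?_
    have : dist (z : E) x ≤ dist (z : E) y + dist x y := by
      rw [dist_comm x y]; exact dist_triangle _ _ _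
    nlinarith
  have hl : ∀ x y, |g0 x - g0 y| ≤ K * dist x y := by
    intro x y
    rw [abs_sub_le_iff]
    have h1 := hl1 x y
    have h2 := hl1 y x
    rw [dist_comm y x] at h2
    constructor <;> linarith
  have hcl : ∀ x ∈ S, |g0 x - f x| ≤ ε := by
    intro x hx
    rw [abs_sub_le_iff]
    constructor
    · have := ciInf_le (hbdd x) ⟨x, hx⟩
      simp only [dist_self, mul_zero, add_zero] at this
      have h2 : g0 x ≤ f x := this
      linarith
    · have : f x - ε ≤ g0 x := by
        refine le_ciInf fun z => ?_
        by_cases hz : dist (z : E) x < δ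
        · have h1 := (abs_le.1 (hmod z z.2 x hx hz)).1
          have h2 : 0 ≤ K * dist (z : E) x := by positivity
          linarith
        · push Not at hz
          have h1 := (abs_le.1 (hM z z.2)).1
          have h2 := (abs_le.1 (hM x hx)).2
          have h3 : K * δ ≤ K * dist (z : E) x := by gcongr
          have h4 : K * δ = 2 * M := by rw [hK]; field_simp
          linarith
      linarith
  have hcont : Continuous g0 := by
    have : LipschitzWith K.toNNReal g0 := by
      apply LipschitzWith.of_dist_le_mul
      intro x y
      rw [Real.coe_toNNReal _ hK0, Real.dist_eq]
      exact hl x y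
    exact this.continuous
  set r : ℝ := ε / (K + 1) with hr
  have hr0 : 0 < r := by positivity
  have hKr : K * r ≤ ε := by
    rw [hr]
    rw [← mul_div_assoc, div_le_iff₀ (by positivity)]
    nlinarith
  let φ : ContDiffBump (0 : E) := ⟨r / 2, r, by positivity, by linarith⟩
  let μ : Measure E := MeasureTheory.Measure.addHaar
  let g : E → ℝ := MeasureTheory.convolution (φ.normed μ) g0 (ContinuousLinearMap.lsmul ℝ ℝ) μ
  have hint : ∀ x, Integrable (fun t => φ.normed μ t * g0 (x - t)) μ := by
    intro x
    apply Continuous.integrable_of_hasCompactSupport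
    · exact φ.continuous_normed.mul (hcont.comp (by fun_prop))
    · exact φ.hasCompactSupport_normed.mul_right
  have hgx : ∀ x, g x = ∫ t, φ.normed μ t * g0 (x - t) ∂μ := by
    intro x
    simp only [g, MeasureTheory.convolution, ContinuousLinearMap.lsmul_apply, smul_eq_mul]
  refine ⟨g, ?_, ?_, ?_⟩
  · exact φ.hasCompactSupport_normed.contDiff_convolution_left (n := 1) _ φ.contDiff_normed
      hcont.locallyIntegrable
  · intro x y
    rw [hgx, hgx, ← integral_sub (hint x) (hint y), ← Real.norm_eq_abs]
    have : ∀ t, ‖φ.normed μ t * g0 (x - t) - φ.normed μ t * g0 (y - t)‖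
        ≤ φ.normed μ t * (K * dist x y) := by
      intro t
      rw [← mul_sub, norm_mul, Real.norm_of_nonneg (φ.nonneg_normed t), Real.norm_eq_abs]
      have := hl (x - t) (y - t)
      rw [dist_sub_right] at this
      exact mul_le_mul_of_nonneg_left this (φ.nonneg_normed t)
    refine (norm_integral_le_of_norm_le (φ.integrable_normed.mul_const _)
      (Eventually.of_forall this)).trans ?_
    rw [integral_mul_const, φ.integral_normed, one_mul]
  · intro x hx
    have h1 : dist (g x) (g0 x) ≤ ε := by
      apply φ.dist_normed_convolution_le hcont.aestronglyMeasurable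
      intro z hz
      rw [Real.dist_eq]
      refine (hl z x).trans (le_trans ?_ hKr)
      have : dist z x < r := hz
      gcongr
    rw [Real.dist_eq] at h1
    have h2 := hcl x hx
    have := abs_sub_le (g x) (g0 x) (f x)
    linarith

lemma smooth_vec (E F : Type*) [NormedAddCommGroup E] [InnerProductSpace ℝ E]
    [FiniteDimensional ℝ E] [MeasurableSpace E] [BorelSpace E]
    [NormedAddCommGroup F] [NormedSpace ℝ F] [FiniteDimensional ℝ F] :
    ∃ C : ℝ, 1 ≤ C ∧ ∀ (S : Set E) (f : E → F) (δ ε : ℝ), 0 < δ → 0 < ε →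
      (∀ x ∈ S, ‖f x‖ ≤ 1) → (∀ x ∈ S, ∀ y ∈ S, dist x y < δ → ‖f x - f y‖ ≤ ε) →
      ∃ g : E → F, ContDiff ℝ 1 g ∧ (∀ x y, ‖g x - g y‖ ≤ C / δ * dist x y) ∧
        ∀ x ∈ S, ‖g x - f x‖ ≤ C * ε := by
  let e := (Module.finBasis ℝ F).equivFunL
  set a : ℝ := ‖(e : F →L[ℝ] (Fin (Module.finrank ℝ F) → ℝ))‖ + 1 with ha
  set b : ℝ := ‖(e.symm : (Fin (Module.finrank ℝ F) → ℝ) →L[ℝ] F)‖ with hb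
  have ha0 : 0 < a := by positivity
  have hb0 : 0 ≤ b := by positivity
  have hea : ∀ v i, |e v i| ≤ a * ‖v‖ := by
    intro v i
    rw [← Real.norm_eq_abs]
    refine (norm_le_pi_norm (e v) i).trans ?_
    refine ((e : F →L[ℝ] (Fin (Module.finrank ℝ F) → ℝ)).le_opNorm v).trans ?_
    gcongr
    linarith
  have heb : ∀ w, ‖e.symm w‖ ≤ b * ‖w‖ := fun w => (e.symm : (Fin (Module.finrank ℝ F) → ℝ) →L[ℝ] F).le_opNorm w
  refine ⟨b * (2 * a) + 1, by simp; positivity, ?_⟩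
  intro S f δ ε hδ hε hf hmod
  have H : ∀ i, ∃ g : E → ℝ, ContDiff ℝ 1 g ∧ (∀ x y, |g x - g y| ≤ 2 * a / δ * dist x y) ∧
      ∀ x ∈ S, |g x - e (f x) i| ≤ 2 * (a * ε) := by
    intro i
    apply smooth_real S (fun x => e (f x) i) a δ (a * ε) hδ (by positivity) ha0.le
    · intro x hx
      refine (hea _ _).trans ?_
      have := hf x hx
      nlinarith
    · intro x hx y hy hxy
      have : e (f x) i - e (f y) i = e (f x - f y) i := by simp
      rw [this]
      refine (hea _ _).trans ?_
      have := hmod x hx y hy hxy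
      gcongr
  choose g hg1 hg2 hg3 using H
  refine ⟨fun x => e.symm (fun i => g i x), ?_, ?_, ?_⟩
  · exact e.symm.contDiff.comp (contDiff_pi.2 hg1)
  · intro x y
    rw [← map_sub]
    refine (heb _).trans ?_
    have : ‖(fun i => g i x) - (fun i => g i y)‖ ≤ 2 * a / δ * dist x y := by
      rw [pi_norm_le_iff_of_nonneg (by positivity)]
      intro i
      exact hg2 i x y
    calc _ ≤ b * (2 * a / δ * dist x y) := by gcongr
      _ = (b * (2 * a)) / δ * dist x y := by ring
      _ ≤ _ := by gcongr; linarith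
  · intro x hx
    have : e.symm (fun i => g i x) - f x = e.symm ((fun i => g i x) - e (f x)) := by simp
    rw [this]
    refine (heb _).trans ?_
    have : ‖(fun i => g i x) - e (f x)‖ ≤ 2 * (a * ε) := by
      rw [pi_norm_le_iff_of_nonneg (by positivity)]
      intro i
      exact hg3 i x hx
    calc _ ≤ b * (2 * (a * ε)) := by gcongr
      _ = (b * (2 * a)) * ε := by ring
      _ ≤ _ := by gcongr; linarith

lemma contDiff_coe_submodule {E F : Type*} [NormedAddCommGroup E] [NormedSpace ℝ E]
    [NormedAddCommGroup F] [NormedSpace ℝ F] (V : Submodule ℝ F) {g : E → V}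
    (hg : ContDiff ℝ 1 g) : ContDiff ℝ 1 (fun x => (g x : F)) :=
  V.subtypeL.contDiff.comp hg

lemma norm_sub_le_of_cross {A : Type*} [NormedRing A] [StarRing A] [NormedStarGroup A]
    {P Q : A} {c : ℝ} (hP : IsSelfAdjoint P) (hQ : IsSelfAdjoint Q)
    (h1 : ‖P * (1 - Q)‖ ≤ c) (h2 : ‖Q * (1 - P)‖ ≤ c) : ‖P - Q‖ ≤ 2 * c := by
  have a3 : ‖(1 - P) * Q‖ ≤ c := by
    have : star (Q * (1 - P)) = (1 - P) * Q := by
      rw [star_mul, hQ.star_eq, star_sub, hP.star_eq, star_one]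
    rw [← this, norm_star]; exact h2
  have e : P - Q = P * (1 - Q) - (1 - P) * Q := by noncomm_ring
  rw [e]
  refine (norm_sub_le _ _).trans ?_
  linarith

lemma tangent_one {m n : ℕ} {R L α : ℝ} {S : Set (EuclideanSpace ℝ (Fin n))}
    {x y : EuclideanSpace ℝ (Fin n)} {T T' : Submodule ℝ (EuclideanSpace ℝ (Fin n))}
    (hR : 0 < R) (hL : 0 < L) (hα : 0 < α)
    (hx : IsGraphPatchAt m n R L α S x T) (hy : IsGraphPatchAt m n R L α S y T')
    (hyS : y ∈ S) (hxy : dist x y < R) (v : T') :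
    ‖projOp Tᗮ (v : EuclideanSpace ℝ (Fin n))‖
      ≤ L * dist x y ^ α * ‖(v : EuclideanSpace ℝ (Fin n))‖ := by
  obtain ⟨-, f, hf, hf0, hdf0, -, hfL, hfS⟩ := hx
  obtain ⟨-, f', hf', hf'0, hdf'0, -, hf'L, hf'S⟩ := hy
  let P := Submodule.orthogonalProjectionOnto T
  let P' := Submodule.orthogonalProjectionOnto Tᗮ
  let c : ℝ → EuclideanSpace ℝ (Fin n) := fun t =>
    y + ((t • v : T') : EuclideanSpace ℝ (Fin n))
      + (f' (t • v) : EuclideanSpace ℝ (Fin n)) - x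
  have hc0 : c 0 = y - x := by simp only [c, zero_smul, hf'0]; simp
  have hd1 : HasDerivAt (fun t : ℝ => t • v) v 0 := by
    simpa only [id, one_smul] using (hasDerivAt_id (0:ℝ)).smul_const v
  have hd2 : HasDerivAt (fun t : ℝ => f' (t • v)) 0 0 := by
    have h1 : HasFDerivAt f' (fderiv ℝ f' 0) ((0:ℝ) • v) := by
      rw [zero_smul]
      exact (hf'.differentiable one_ne_zero 0).hasFDerivAt
    have := h1.comp_hasDerivAt (0:ℝ) hd1
    rw [hdf'0] at this
    exact this
  have hcd : HasDerivAt c (v : EuclideanSpace ℝ (Fin n)) 0 := by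
    have h1 := T'.subtypeL.hasFDerivAt.comp_hasDerivAt (0:ℝ) hd1
    have h2 := T'ᗮ.subtypeL.hasFDerivAt.comp_hasDerivAt (0:ℝ) hd2
    have := ((h1.const_add y).add h2).sub_const x
    have hz : T'.subtypeL v + T'ᗮ.subtypeL 0 = (v : EuclideanSpace ℝ (Fin n)) := by simp
    rw [hz] at this
    exact this
  have hcc : ContinuousAt c 0 := hcd.continuousAt
  have hev : ∀ᶠ t in 𝓝 (0:ℝ), P' (c t) = f (P (c t)) := by
    have e1 : ∀ᶠ t in 𝓝 (0:ℝ), x + c t ∈ ball y R := by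
      have h1 : ContinuousAt (fun t => x + c t) 0 := continuousAt_const.add hcc
      apply h1.eventually_mem
      rw [hc0]
      exact isOpen_ball.mem_nhds (by simpa using hR)
    have e2 : ∀ᶠ t in 𝓝 (0:ℝ), x + c t ∈ ball x R := by
      have h1 : ContinuousAt (fun t => x + c t) 0 := continuousAt_const.add hcc
      apply h1.eventually_mem
      rw [hc0]
      exact isOpen_ball.mem_nhds (by simpa [dist_comm] using hxy)
    filter_upwards [e1, e2] with t h1 h2
    have h3 : x + c t ∈ S ∩ ball y R := by
      rw [hf'S]
      exact ⟨⟨t • v, by simp only [c]; abel⟩, h1⟩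
    have h4 : x + c t ∈ S ∩ ball x R := ⟨h3.1, h2⟩
    rw [hfS] at h4
    obtain ⟨⟨ξ, hξ⟩, -⟩ := h4
    have h5 : c t = (ξ : EuclideanSpace ℝ (Fin n)) + (f ξ : EuclideanSpace ℝ (Fin n)) := by
      have : x + c t = x + ((ξ : EuclideanSpace ℝ (Fin n)) + (f ξ : EuclideanSpace ℝ (Fin n))) := by
        rw [← hξ]; simp only; abel
      exact add_left_cancel this
    have h6 : P (c t) = ξ := by
      rw [h5, map_add]
      simp [P]
    have h7 : P' (c t) = f ξ := by
      rw [h5, map_add]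
      simp [P']
    rw [h6, h7]
  have D1 : HasDerivAt (fun t => P' (c t)) (P' v) 0 := P'.hasFDerivAt.comp_hasDerivAt (0:ℝ) hcd
  have D2 : HasDerivAt (fun t => f (P (c t))) (fderiv ℝ f (P (c 0)) (P v)) 0 :=
    (hf.differentiable one_ne_zero (P (c 0))).hasFDerivAt.comp_hasDerivAt (0:ℝ)
      (P.hasFDerivAt.comp_hasDerivAt (0:ℝ) hcd)
  have heq : P' v = fderiv ℝ f (P (c 0)) (P v) :=
    D1.unique (D2.congr_of_eventuallyEq hev)
  have hn : ‖projOp Tᗮ v‖ = ‖P' v‖ := rfl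
  have hPle : ∀ w, ‖P w‖ ≤ ‖w‖ := fun w => by
    have := (T.orthogonalProjectionOnto).le_of_opNorm_le
      (Submodule.orthogonalProjectionOnto_norm_le T) w
    rwa [one_mul] at this
  rw [hn, heq]
  refine (ContinuousLinearMap.le_opNorm _ _).trans ?_
  have h1 : ‖fderiv ℝ f (P (c 0))‖ ≤ L * dist x y ^ α := by
    have := hfL (P (c 0)) 0
    rw [hdf0, sub_zero, sub_zero] at this
    refine this.trans ?_
    have h2 : ‖P (c 0)‖ ≤ dist x y := by
      refine (hPle _).trans ?_
      rw [hc0, dist_comm, dist_eq_norm]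
    gcongr
  gcongr
  exact hPle v

lemma tangent_two {m n : ℕ} {R L α : ℝ} {S : Set (EuclideanSpace ℝ (Fin n))}
    {x y : EuclideanSpace ℝ (Fin n)} {T T' : Submodule ℝ (EuclideanSpace ℝ (Fin n))}
    (hR : 0 < R) (hL : 0 < L) (hα : 0 < α)
    (hx : IsGraphPatchAt m n R L α S x T) (hy : IsGraphPatchAt m n R L α S y T')
    (hxS : x ∈ S) (hyS : y ∈ S) (hxy : dist x y < R) :
    ‖projOp Tᗮ - projOp T'ᗮ‖ ≤ 2 * L * dist x y ^ α := by
  set P : EuclideanSpace ℝ (Fin n) →L[ℝ] EuclideanSpace ℝ (Fin n) := projOp Tᗮ with hP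
  set Q : EuclideanSpace ℝ (Fin n) →L[ℝ] EuclideanSpace ℝ (Fin n) := projOp T'ᗮ with hQ
  have hPs : IsSelfAdjoint P := isSelfAdjoint_starProjection Tᗮ
  have hQs : IsSelfAdjoint Q := isSelfAdjoint_starProjection T'ᗮ
  have hP1 : 1 - P = projOp T := by
    have : P = 1 - T.starProjection := Submodule.starProjection_orthogonal' T
    rw [this, sub_sub_cancel]; rfl
  have hQ1 : 1 - Q = projOp T' := by
    have : Q = 1 - T'.starProjection := Submodule.starProjection_orthogonal' T'
    rw [this, sub_sub_cancel]; rfl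
  have ple : ∀ (U : Submodule ℝ (EuclideanSpace ℝ (Fin n))) w, ‖projOp U w‖ ≤ ‖w‖ := fun U w =>
    U.norm_starProjection_apply_le w
  have pmem : ∀ (U : Submodule ℝ (EuclideanSpace ℝ (Fin n))) w, projOp U w ∈ U := fun U w =>
    U.starProjection_apply_mem w
  have a1 : ‖P * (1 - Q)‖ ≤ L * dist x y ^ α := by
    refine ContinuousLinearMap.opNorm_le_bound _ (by positivity) fun w => ?_
    rw [hQ1]
    refine (tangent_one hR hL hα hx hy hyS hxy ⟨projOp T' w, pmem _ _⟩).trans ?_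
    gcongr
    exact ple _ _
  have a2 : ‖Q * (1 - P)‖ ≤ L * dist x y ^ α := by
    refine ContinuousLinearMap.opNorm_le_bound _ (by positivity) fun w => ?_
    rw [hP1]
    rw [dist_comm] at hxy ⊢
    refine (tangent_one hR hL hα hy hx hxS hxy ⟨projOp T w, pmem _ _⟩).trans ?_
    gcongr
    exact ple _ _
  have := norm_sub_le_of_cross hPs hQs a1 a2
  linarith

lemma finrank_le_of_close {n : ℕ} (U V : Submodule ℝ (EuclideanSpace ℝ (Fin n)))
    (h : ‖projOp U - projOp V‖ < 1) : Module.finrank ℝ U ≤ Module.finrank ℝ V := by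
  let φ : U →ₗ[ℝ] V := (Submodule.orthogonalProjectionOnto V).toLinearMap ∘ₗ U.subtype
  apply LinearMap.finrank_le_finrank_of_injective (f := φ)
  rw [← LinearMap.ker_eq_bot, LinearMap.ker_eq_bot']
  intro u hu
  have h1 : projOp V u = 0 := by
    have : projOp V u = (φ u : EuclideanSpace ℝ (Fin n)) := rfl
    rw [this, hu]; rfl
  have h2 : projOp U u = u := Submodule.starProjection_eq_self_iff.2 u.2
  by_contra hne
  have h3 : 0 < ‖(u : EuclideanSpace ℝ (Fin n))‖ := by
    rw [norm_pos_iff]; simpa using hne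
  have h4 := (projOp U - projOp V).le_opNorm u
  rw [sub_apply, h1, h2, sub_zero] at h4
  nlinarith

/-- **Nearly normal spaces of class `C¹`** (Lemma 4.2): for `Σ ∈ C^{1,α}_{m,n}(R,L,d)`
and any `ε ∈ (0,1]` there is an `ε`-normal map for `Σ` with Lipschitz constant at most
`C ε^{-1/α}`, where `C ≥ 1` depends only on `L, R, α, m, n`. -/
theorem exists_eps_normal_map (m n : ℕ) (R L α : ℝ)
    (hm : 1 ≤ m) (hmn : m < n) (hR : 0 < R) (hL : 0 < L) (hα : 0 < α) (hα1 : α ≤ 1) :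
    ∃ C : ℝ, 1 ≤ C ∧ ∀ d : ℝ, 0 < d → ∀ S : Set (EuclideanSpace ℝ (Fin n)),
      InClassC1 m n R L d α S → ∀ ε : ℝ, 0 < ε → ε ≤ 1 →
      ∃ (Φ : EuclideanSpace ℝ (Fin n) →
            (EuclideanSpace ℝ (Fin n) →L[ℝ] EuclideanSpace ℝ (Fin n))) (K : ℝ≥0),
        IsNormalMap m n R L α ε S Φ K ∧ (K : ℝ) ≤ C * ε ^ (-(1 / α)) := by
  have hn0 : 0 < n := by omega
  have : Nonempty (Fin n) := ⟨⟨0, hn0⟩⟩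
  obtain ⟨G, O, Kg, hKg, hO, hGC, hG1, hG2⟩ := exists_retr (EuclideanSpace ℝ (Fin n))
  obtain ⟨C1, hC1, hsm⟩ := smooth_vec (EuclideanSpace ℝ (Fin n))
    (selfAdjoint.submodule ℝ (EuclideanSpace ℝ (Fin n) →L[ℝ] EuclideanSpace ℝ (Fin n)))
  have hKg0 : 0 < Kg := by linarith
  have hC10 : 0 < C1 := by linarith
  set Q : ℝ := 1 / R + (32 * L * Kg * C1) ^ (1 / α) with hQ
  have hQ0 : 0 < Q := by positivity
  refine ⟨Kg * C1 * Q + 1, by simp; positivity, ?_⟩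
  rintro d - S ⟨-, -, -, hS⟩ ε hε hε1
  choose! T hT using hS
  set ε' : ℝ := ε / (16 * Kg * C1) with hε'
  have hε'0 : 0 < ε' := by positivity
  set s : ℝ := (ε' / (2 * L)) ^ (1 / α) with hs
  have hs0 : 0 < s := by positivity
  set δ : ℝ := min R s with hδ
  have hδ0 : 0 < δ := lt_min hR hs0
  have hproj : ∀ U : Submodule ℝ (EuclideanSpace ℝ (Fin n)), IsStarProjection (projOp U) :=
    fun U => isStarProjection_starProjection
  have hproj1 : ∀ U : Submodule ℝ (EuclideanSpace ℝ (Fin n)), ‖projOp U‖ ≤ 1 :=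
    fun U => U.starProjection_norm_le
  obtain ⟨g, hgC, hgL, hgA⟩ := hsm S (fun x => ⟨projOp (T x)ᗮ, (hproj _).isSelfAdjoint⟩) δ ε' hδ0 hε'0
    (fun x _ => hproj1 _)
    (by
      intro x hx y hy hxy
      have h1 : dist x y < R := hxy.trans_le (min_le_left _ _)
      have h2 : dist x y ≤ s := (hxy.trans_le (min_le_right _ _)).le
      refine (tangent_two hR hL hα (hT x hx) (hT y hy) hx hy h1).trans ?_
      calc 2 * L * dist x y ^ α ≤ 2 * L * s ^ α := by gcongr
        _ = ε' := by
          rw [hs, ← Real.rpow_mul (by positivity), one_div_mul_cancel hα.ne', Real.rpow_one]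
          field_simp)
  have hgA' : ∀ x ∈ S, ‖(g x : EuclideanSpace ℝ (Fin n) →L[ℝ] EuclideanSpace ℝ (Fin n))
      - projOp (T x)ᗮ‖ ≤ C1 * ε' := fun x hx => hgA x hx
  have hgL' : ∀ x y, ‖(g x : EuclideanSpace ℝ (Fin n) →L[ℝ] EuclideanSpace ℝ (Fin n))
      - g y‖ ≤ C1 / δ * dist x y := fun x y => hgL x y
  have hgs : ∀ x, IsSelfAdjoint
      (g x : EuclideanSpace ℝ (Fin n) →L[ℝ] EuclideanSpace ℝ (Fin n)) := fun x => (g x).2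
  have hgC' : ContDiff ℝ 1 (fun x =>
      (g x : EuclideanSpace ℝ (Fin n) →L[ℝ] EuclideanSpace ℝ (Fin n))) :=
    contDiff_coe_submodule _ hgC
  have hce : Kg * (C1 * ε') = ε / 16 := by rw [hε']; field_simp
  have hsmall : C1 * ε' ≤ 1 / 16 := by
    have : 0 < C1 * ε' := by positivity
    nlinarith
  have hgA16 : ∀ x ∈ S, ‖(g x : EuclideanSpace ℝ (Fin n) →L[ℝ] EuclideanSpace ℝ (Fin n))
      - projOp (T x)ᗮ‖ ≤ 1 / 16 := fun x hx => (hgA' x hx).trans hsmall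
  have hcl : ∀ x ∈ S, ‖G (g x) - projOp (T x)ᗮ‖ ≤ ε / 16 := by
    intro x hx
    refine (hG1 _ _ (hproj _) (hproj1 _) (hgs x) (hgA16 x hx)).2.2.trans ?_
    rw [← hce]
    have := hgA' x hx
    gcongr
  have hKnn : 0 ≤ Kg * (C1 / δ) := by positivity
  refine ⟨fun x => G (g x), (Kg * (C1 / δ)).toNNReal, ⟨?_, ?_, ?_, ?_⟩, ?_⟩
  · refine ⟨(fun x => (g x : EuclideanSpace ℝ (Fin n) →L[ℝ] EuclideanSpace ℝ (Fin n))) ⁻¹' O,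
      hO.preimage hgC'.continuous, ?_, ?_⟩
    · intro x hx
      exact (hG1 _ _ (hproj _) (hproj1 _) (hgs x) (hgA16 x hx)).1
    · exact hGC.comp hgC'.contDiffOn (fun x hx => hx)
  · apply LipschitzOnWith.of_dist_le_mul
    intro x hx y hy
    rw [Real.coe_toNNReal _ hKnn, dist_eq_norm]
    refine (hG2 _ _ _ _ (hproj _) (hproj1 _) (hgs x) (hgA16 x hx) (hproj _) (hproj1 _) (hgs y)
      (hgA16 y hy)).trans ?_
    rw [mul_assoc]
    have := hgL' x y
    gcongr
  · intro x hx
    have h1 := (hG1 _ _ (hproj _) (hproj1 _) (hgs x) (hgA16 x hx)).2.1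
    obtain ⟨W, hWo, hW⟩ := isStarProjection_iff_eq_starProjection.1 h1
    have hW' : G (g x) = projOp W := hW
    have h2 := hcl x hx
    rw [hW'] at h2
    have h3 : ‖projOp W - projOp (T x)ᗮ‖ < 1 := by linarith
    refine ⟨W, ?_, hW'⟩
    have h4 := finrank_le_of_close _ _ h3
    have h5 := finrank_le_of_close _ _ (by rwa [norm_sub_rev] at h3)
    have h6 := (T x).finrank_add_finrank_orthogonal
    rw [(hT x hx).1, finrank_euclideanSpace_fin] at h6
    omega
  · intro x hx T' hT'
    have h1 := tangent_two hR hL hα (hT x hx) hT' hx hx (by simpa using hR)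
    rw [dist_self, Real.zero_rpow hα.ne', mul_zero] at h1
    have h2 : projOp (T x)ᗮ = projOp T'ᗮ := by
      rw [← sub_eq_zero]; exact norm_le_zero_iff.1 h1
    rw [← h2]
    exact (hcl x hx).trans (by linarith)
  · rw [Real.coe_toNNReal _ hKnn]
    have hpow : (1:ℝ) ≤ ε ^ (-(1 / α)) :=
      Real.one_le_rpow_of_pos_of_le_one_of_nonpos hε hε1 (by
        have : 0 < 1 / α := by positivity
        linarith)
    have hsinv : 1 / s = (32 * L * Kg * C1) ^ (1 / α) * ε ^ (-(1 / α)) := by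
      have e1 : ε' / (2 * L) = ε / (32 * L * Kg * C1) := by rw [hε']; field_simp; norm_num
      rw [hs, e1, Real.div_rpow hε.le (by positivity), Real.rpow_neg hε.le]
      field_simp
    have hδinv : 1 / δ ≤ Q * ε ^ (-(1 / α)) := by
      have h1 : 1 / δ ≤ 1 / R + 1 / s := by
        rcases min_choice R s with h | h
        · rw [hδ, h]; have : 0 < 1 / s := by positivity
          linarith
        · rw [hδ, h]; have : 0 < 1 / R := by positivity
          linarith
      rw [hsinv] at h1
      refine h1.trans ?_
      rw [hQ, add_mul]
      have : 1 / R ≤ 1 / R * ε ^ (-(1 / α)) := le_mul_of_one_le_right (by positivity) hpow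
      linarith
    calc Kg * (C1 / δ) = Kg * C1 * (1 / δ) := by ring
      _ ≤ Kg * C1 * (Q * ε ^ (-(1 / α))) := by gcongr
      _ = Kg * C1 * Q * ε ^ (-(1 / α)) := by ring
      _ ≤ _ := by gcongr; linarith
end
end

section
/- Fix integers 1 ≤ m < n, constants R, L, d > 0 and α ∈ (0,1], let Σ ∈ C^{1,α}_{m,n}(R,L,d), let ε ∈ (0, 1/100), and let Φ : Σ → Hom(ℝⁿ,ℝⁿ) be an ε-normal map for Σ. Then there exists δ_tub > 0 (depending only on R, L, α, ε, and lip(Φ)) such that for all δ ∈ (0, δ_tub], the map Ψ = Ψ_δ[Σ,Φ] satisfies: (i) Ψ is a C¹ embedding of N_δ(Σ,Φ) into ℝⁿ; (ii) (1/4)|(x−y, u−v)| ≤ |Ψ(x,u) − Ψ(y,v)| ≤ √2 |(x−y, u−v)| for all (x,u), (y,v) ∈ N_δ(Σ,Φ); (iii) dist(Ψ(x,v), Σ) > |v|/4 for all (x,v) ∈ N_δ(Σ,Φ) with v ≠ 0; and (iv) Σ + B(0, δ/2) ⊆ Ψ(N_δ(Σ,Φ)). -/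
open Set Metric MeasureTheory Filter Topology
open scoped ENNReal NNReal

noncomputable section

/-- The `δ`-normal neighbourhood `N_δ(S,Φ) = {(x,v) : x ∈ S, Φ(x)v = v, |v| < δ}`. -/
def normalNbhd {n : ℕ} (S : Set (EuclideanSpace ℝ (Fin n)))
    (Φ : EuclideanSpace ℝ (Fin n) → (EuclideanSpace ℝ (Fin n) →L[ℝ] EuclideanSpace ℝ (Fin n)))
    (δ : ℝ) : Set (EuclideanSpace ℝ (Fin n) × EuclideanSpace ℝ (Fin n)) :=
  {p | p.1 ∈ S ∧ Φ p.1 p.2 = p.2 ∧ ‖p.2‖ < δ}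

/-- `δ` is a tubular radius for `(S,Φ)`: the map `Ψ(x,v) = x + v` restricted to
`N_δ(S,Φ)` is an embedding, bilipschitz for the Euclidean product metric with constants
`1/4` and `√2`, with `dist(Ψ(x,v),S) > |v|/4` for `v ≠ 0`, and whose image contains the
`δ/2`-neighbourhood of `S`. -/
def IsTubularRadius {n : ℕ} (S : Set (EuclideanSpace ℝ (Fin n)))
    (Φ : EuclideanSpace ℝ (Fin n) → (EuclideanSpace ℝ (Fin n) →L[ℝ] EuclideanSpace ℝ (Fin n)))
    (δ : ℝ) : Prop :=
  IsEmbedding ((normalNbhd S Φ δ).restrict fun p => p.1 + p.2) ∧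
  (∀ p ∈ normalNbhd S Φ δ, ∀ q ∈ normalNbhd S Φ δ,
    (1 / 4) * Real.sqrt (dist p.1 q.1 ^ 2 + dist p.2 q.2 ^ 2) ≤ dist (p.1 + p.2) (q.1 + q.2) ∧
    dist (p.1 + p.2) (q.1 + q.2) ≤ Real.sqrt 2 * Real.sqrt (dist p.1 q.1 ^ 2 + dist p.2 q.2 ^ 2)) ∧
  (∀ p ∈ normalNbhd S Φ δ, p.2 ≠ 0 → ‖p.2‖ / 4 < Metric.infDist (p.1 + p.2) S) ∧
  (∀ z : EuclideanSpace ℝ (Fin n), (∃ s ∈ S, dist z s < δ / 2) →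
    z ∈ (fun p : EuclideanSpace ℝ (Fin n) × EuclideanSpace ℝ (Fin n) => p.1 + p.2) ''
      normalNbhd S Φ δ)

theorem patch_normal_bound {m n : ℕ} {R L α : ℝ} (hα : 0 < α) (hL : 0 < L)
    {S : Set (EuclideanSpace ℝ (Fin n))} {x y : EuclideanSpace ℝ (Fin n)}
    {T : Submodule ℝ (EuclideanSpace ℝ (Fin n))} (h : IsGraphPatchAt m n R L α S x T)
    (hy : y ∈ S) (hxy : dist y x < R) :
    ‖projOp Tᗮ (y - x)‖ ≤ L * ‖y - x‖ ^ α * ‖y - x‖ := by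
  obtain ⟨-, f, hf, hf0, hdf0, -, hH, hS⟩ := h
  have hmem : y ∈ S ∩ Metric.ball x R := ⟨hy, hxy⟩
  rw [hS] at hmem
  obtain ⟨⟨ξ, hξ⟩, -⟩ := hmem
  have e : y - x = (ξ : EuclideanSpace ℝ (Fin n)) + (f ξ : EuclideanSpace ℝ (Fin n)) := by
    rw [← hξ]; simp only; abel
  have hP : projOp Tᗮ (y - x) = (f ξ : EuclideanSpace ℝ (Fin n)) := by
    rw [e]
    simp only [projOp, ContinuousLinearMap.comp_apply, map_add, Submodule.subtypeL_apply]
    rw [Submodule.orthogonalProjectionOnto_mem_subspace_eq_self,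
      Submodule.orthogonalProjectionOnto_apply_of_mem_orthogonal]
    · simp
    · exact Submodule.le_orthogonal_orthogonal T ξ.2
  have hξn : ‖ξ‖ ≤ ‖y - x‖ := by
    have h1 : ‖y - x‖ * ‖y - x‖ = ‖(ξ : EuclideanSpace ℝ (Fin n))‖ * ‖(ξ : EuclideanSpace ℝ (Fin n))‖ + ‖(f ξ : EuclideanSpace ℝ (Fin n))‖ * ‖(f ξ : EuclideanSpace ℝ (Fin n))‖ := by
      rw [e]
      exact norm_add_sq_eq_norm_sq_add_norm_sq_of_inner_eq_zero _ _
        (Submodule.inner_right_of_mem_orthogonal ξ.2 (f ξ).2)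
    have h2 : ‖ξ‖ = ‖(ξ : EuclideanSpace ℝ (Fin n))‖ := rfl
    rw [h2]
    nlinarith [norm_nonneg (y - x), norm_nonneg (ξ : EuclideanSpace ℝ (Fin n)), norm_nonneg (f ξ : EuclideanSpace ℝ (Fin n))]
  have hmv : ‖f ξ - f 0‖ ≤ (L * ‖ξ‖ ^ α) * ‖ξ - 0‖ := by
    refine (convex_closedBall (0 : T) ‖ξ‖).norm_image_sub_le_of_norm_fderiv_le (𝕜 := ℝ)
      (fun z _ => hf.differentiable (by norm_num) z) ?_ (by simp) (by simp)
    intro z hz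
    have := hH z 0
    rw [hdf0, sub_zero, sub_zero] at this
    refine this.trans ?_
    have : ‖z‖ ≤ ‖ξ‖ := by simpa using hz
    gcongr
  rw [hf0, sub_zero, sub_zero] at hmv
  rw [hP]
  refine le_trans hmv ?_
  gcongr

theorem local_lower {E : Type*} [NormedAddCommGroup E] [InnerProductSpace ℝ E] (a b : E)
    (h : |inner ℝ a b| ≤ 11 / 100 * ‖a‖ * ‖b‖ + 1 / 100 * ‖a‖ ^ 2) :
    1 / 4 * (‖a‖ ^ 2 + ‖b‖ ^ 2) ≤ ‖a + b‖ ^ 2 := by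
  rw [norm_add_sq_real]
  have := (abs_le.1 h).1
  nlinarith [sq_nonneg (‖a‖ - ‖b‖), sq_nonneg ‖a‖, sq_nonneg ‖b‖]

theorem projOp_idem {n : ℕ} (W : Submodule ℝ (EuclideanSpace ℝ (Fin n)))
    (v : EuclideanSpace ℝ (Fin n)) : projOp W (projOp W v) = projOp W v := by
  change ((W.orthogonalProjectionOnto ((W.orthogonalProjectionOnto v : W) : EuclideanSpace ℝ (Fin n)) : W) : EuclideanSpace ℝ (Fin n)) = (W.orthogonalProjectionOnto v : W)
  rw [Submodule.orthogonalProjectionOnto_mem_subspace_eq_self]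

theorem projOp_inner {n : ℕ} (W : Submodule ℝ (EuclideanSpace ℝ (Fin n)))
    (v w : EuclideanSpace ℝ (Fin n)) : inner ℝ (projOp W v) w = inner ℝ v (projOp W w) := by
  simp only [projOp, ContinuousLinearMap.comp_apply, Submodule.subtypeL_apply]
  exact Submodule.inner_starProjection_left_eq_right W v w

theorem projOp_norm {n : ℕ} (W : Submodule ℝ (EuclideanSpace ℝ (Fin n)))
    (v : EuclideanSpace ℝ (Fin n)) : ‖projOp W v‖ ≤ ‖v‖ :=
  W.norm_orthogonalProjectionOnto_apply_le v

theorem projOp_add_orth {n : ℕ} (W : Submodule ℝ (EuclideanSpace ℝ (Fin n)))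
    (v : EuclideanSpace ℝ (Fin n)) : projOp W v + projOp Wᗮ v = v :=
  W.starProjection_add_starProjection_orthogonal v

theorem tub_surj {m n : ℕ} {R L α ε δ : ℝ} {K : ℝ≥0} {S : Set (EuclideanSpace ℝ (Fin n))}
    {Φ : EuclideanSpace ℝ (Fin n) → (EuclideanSpace ℝ (Fin n) →L[ℝ] EuclideanSpace ℝ (Fin n))}
    (hΦ : IsNormalMap m n R L α ε S Φ K) (hε0 : 0 < ε) (hε : ε < 1 / 100) (hδ : 0 < δ)
    (hδR : 2 * δ < R) (hKδ : K * δ ≤ 1 / 100) {s z : EuclideanSpace ℝ (Fin n)}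
    {T : Submodule ℝ (EuclideanSpace ℝ (Fin n))} (hT : IsGraphPatchAt m n R L α S s T)
    (hs : s ∈ S) (hz : dist z s < δ / 2) :
    ∃ x ∈ S, dist x s ≤ 2 * δ ∧ Φ x (z - x) = z - x := by
  obtain ⟨-, hlip, hW, hclose⟩ := hΦ
  have hcl := hclose s hs T hT
  obtain ⟨-, f, hf, hf0, hdf0, hf1, -, hS⟩ := hT
  have hflip : ∀ ξ η : T, ‖f ξ - f η‖ ≤ ‖ξ - η‖ := fun ξ η => by
    simpa [dist_eq_norm] using hf1.dist_le_mul ξ η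
  set X : T → EuclideanSpace ℝ (Fin n) := fun ξ =>
    s + (ξ : EuclideanSpace ℝ (Fin n)) + (f ξ : EuclideanSpace ℝ (Fin n)) with hX
  have hX0 : X 0 = s := by simp [hX, hf0]
  have hXd : ∀ ξ η : T, X ξ - X η = ((ξ - η : T) : EuclideanSpace ℝ (Fin n))
      + ((f ξ - f η : Tᗮ) : EuclideanSpace ℝ (Fin n)) := by
    intro ξ η; simp only [hX, Submodule.coe_sub]; abel
  have hXl : ∀ ξ η : T, ‖X ξ - X η‖ ≤ 2 * ‖ξ - η‖ := by
    intro ξ η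
    rw [hXd]
    refine (norm_add_le _ _).trans ?_
    have h1 : ‖((f ξ - f η : Tᗮ) : EuclideanSpace ℝ (Fin n))‖ ≤ ‖ξ - η‖ := hflip ξ η
    have h2 : ‖((ξ - η : T) : EuclideanSpace ℝ (Fin n))‖ = ‖ξ - η‖ := rfl
    linarith
  have hXs : ∀ ξ : T, ‖ξ‖ ≤ δ → ‖X ξ - s‖ ≤ 2 * δ := by
    intro ξ hξ
    have := hXl ξ 0
    rw [hX0, sub_zero] at this
    linarith
  have hXS : ∀ ξ : T, ‖ξ‖ ≤ δ → X ξ ∈ S := by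
    intro ξ hξ
    have : X ξ ∈ S ∩ Metric.ball s R := by
      rw [hS]
      refine ⟨⟨ξ, rfl⟩, ?_⟩
      rw [Metric.mem_ball, dist_eq_norm]
      linarith [hXs ξ hξ]
    exact this.1
  have hΦl : ∀ x ∈ S, ∀ y ∈ S, ‖Φ x - Φ y‖ ≤ K * ‖x - y‖ := by
    intro x hx y hy
    simpa [dist_eq_norm] using hlip.dist_le_mul x hx y hy
  -- closeness to the base normal projection
  have hD : ∀ ξ : T, ‖ξ‖ ≤ δ → ∀ w, ‖Φ (X ξ) w - projOp Tᗮ w‖ ≤ 3 / 100 * ‖w‖ := by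
    intro ξ hξ w
    have h1 := hΦl _ (hXS ξ hξ) s hs
    have h2 : (K : ℝ) * ‖X ξ - s‖ ≤ K * (2 * δ) := by gcongr; exact hXs ξ hξ
    have h3 : ‖Φ (X ξ) - projOp Tᗮ‖ ≤ 3 / 100 := by
      have := norm_sub_le_norm_sub_add_norm_sub (Φ (X ξ)) (Φ s) (projOp Tᗮ)
      linarith
    calc _ = ‖(Φ (X ξ) - projOp Tᗮ) w‖ := by simp
      _ ≤ _ := ContinuousLinearMap.le_of_opNorm_le _ h3 w
  let π := T.orthogonalProjectionOnto
  have hπ : ∀ w, ‖π w‖ ≤ ‖w‖ := fun w => T.norm_orthogonalProjectionOnto_apply_le w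
  let F : T → T := fun ξ => ξ + π ((z - X ξ) - Φ (X ξ) (z - X ξ))
  have hπX : ∀ ξ η : T, π (X ξ - X η) = ξ - η := by
    intro ξ η
    rw [hXd, map_add]
    simp only [π]
    rw [Submodule.orthogonalProjectionOnto_mem_subspace_eq_self,
      Submodule.orthogonalProjectionOnto_apply_of_mem_orthogonal (SetLike.coe_mem _), add_zero]
  have hπo : ∀ w, π (projOp Tᗮ w) = 0 := fun w =>
    Submodule.orthogonalProjectionOnto_apply_of_mem_orthogonal (SetLike.coe_mem _)
  have hFd : ∀ ξ η : T, ‖ξ‖ ≤ δ → ‖η‖ ≤ δ → ‖F ξ - F η‖ ≤ 1 / 2 * ‖ξ - η‖ := by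
    intro ξ η hξ hη
    have e : F ξ - F η = π (Φ (X ξ) (X ξ - X η) - projOp Tᗮ (X ξ - X η))
        - π ((Φ (X ξ) - Φ (X η)) (z - X η)) := by
      have h1 := hπX ξ η
      have h2 := hπo (X ξ - X η)
      rw [map_sub π (Φ (X ξ) (X ξ - X η)), h2]
      simp only [F, map_sub, ContinuousLinearMap.sub_apply] at h1 ⊢
      have h3 : π (X ξ) = ξ - η + π (X η) := sub_eq_iff_eq_add.1 h1
      rw [h3]
      abel
    rw [e]
    have a1 := (hπ (Φ (X ξ) (X ξ - X η) - projOp Tᗮ (X ξ - X η))).trans (hD ξ hξ _)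
    have a2 := (hπ ((Φ (X ξ) - Φ (X η)) (z - X η))).trans
      (ContinuousLinearMap.le_of_opNorm_le _ (hΦl _ (hXS ξ hξ) _ (hXS η hη)) _)
    have a3 : ‖z - X η‖ ≤ 3 * δ := by
      have h1 := norm_sub_le_norm_sub_add_norm_sub z s (X η)
      have h2 := hXs η hη
      rw [norm_sub_rev] at h2
      rw [dist_eq_norm] at hz
      linarith
    have a4 := hXl ξ η
    have a5 : (K : ℝ) * ‖X ξ - X η‖ * ‖z - X η‖ ≤ K * (2 * ‖ξ - η‖) * (3 * δ) := by gcongr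
    have a6 := mul_le_mul_of_nonneg_right hKδ (norm_nonneg (ξ - η))
    have a7 := norm_sub_le (π (Φ (X ξ) (X ξ - X η) - projOp Tᗮ (X ξ - X η)))
      (π ((Φ (X ξ) - Φ (X η)) (z - X η)))
    have := norm_nonneg (ξ - η)
    nlinarith
  have hF0 : ‖F 0‖ ≤ δ / 2 := by
    simp only [F, hX0, zero_add]
    refine (hπ _).trans ?_
    obtain ⟨W, -, hW⟩ := hW s hs
    rw [hW]
    have h1 := projOp_add_orth W (z - s)
    have h2 : z - s - projOp W (z - s) = projOp Wᗮ (z - s) := by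
      rw [sub_eq_iff_eq_add, add_comm]; exact h1.symm
    rw [h2]
    refine (projOp_norm _ _).trans ?_
    rw [← dist_eq_norm]; exact hz.le
  have hmaps : Set.MapsTo F (closedBall 0 δ) (closedBall 0 δ) := by
    intro ξ hξ
    simp only [mem_closedBall, dist_zero_right] at hξ ⊢
    have h1 := hFd ξ 0 hξ (by simpa using hδ.le)
    rw [sub_zero] at h1
    have h2 := norm_le_norm_add_norm_sub' (F ξ) (F 0)
    linarith
  have hcontr : ContractingWith (1 / 2) (hmaps.restrict F (closedBall 0 δ) (closedBall 0 δ)) := by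
    refine ⟨by norm_num, LipschitzWith.of_dist_le_mul ?_⟩
    rintro ⟨ξ, hξ⟩ ⟨η, hη⟩
    simp only [mem_closedBall, dist_zero_right] at hξ hη
    simpa [Subtype.dist_eq, dist_eq_norm] using hFd ξ η hξ hη
  obtain ⟨ξ, hξ, hfix, -⟩ := hcontr.exists_fixedPoint'
    (isClosed_closedBall (x := (0 : T)) (ε := δ)).isComplete hmaps
    (x := 0) (by simpa using hδ.le) (edist_ne_top _ _)
  simp only [mem_closedBall, dist_zero_right] at hξ
  refine ⟨X ξ, hXS ξ hξ, by rw [dist_eq_norm]; exact hXs ξ hξ, ?_⟩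
  have hπ0 : π ((z - X ξ) - Φ (X ξ) (z - X ξ)) = 0 := by
    have : F ξ = ξ := hfix
    simpa [F] using this
  set w' := (z - X ξ) - Φ (X ξ) (z - X ξ) with hw'
  have hΦw : Φ (X ξ) w' = 0 := by
    obtain ⟨W, -, hW⟩ := hW _ (hXS ξ hξ)
    rw [hw', hW, map_sub, projOp_idem, sub_self]
  have hTw : projOp Tᗮ w' = w' := by
    have h1 := projOp_add_orth T w'
    have h2 : projOp T w' = 0 := by
      change ((π w' : T) : EuclideanSpace ℝ (Fin n)) = 0
      rw [hπ0]; rfl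
    rwa [h2, zero_add] at h1
  have h1 := hD ξ hξ w'
  rw [hΦw, hTw, zero_sub, norm_neg] at h1
  have h2 : w' = 0 := norm_eq_zero.1 (by linarith [norm_nonneg w'])
  exact (sub_eq_zero.1 h2).symm

theorem tub_normal {m n : ℕ} {R L α ε r : ℝ} {K : ℝ≥0} {S : Set (EuclideanSpace ℝ (Fin n))}
    {Φ : EuclideanSpace ℝ (Fin n) → (EuclideanSpace ℝ (Fin n) →L[ℝ] EuclideanSpace ℝ (Fin n))}
    (hα : 0 < α) (hL : 0 < L)
    (hpatch : ∀ x ∈ S, ∃ T, IsGraphPatchAt m n R L α S x T)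
    (hΦ : IsNormalMap m n R L α ε S Φ K) (hε : ε < 1 / 100)
    (hrR : r ≤ R) (hr : L * r ^ α ≤ 1 / 10) {x y : EuclideanSpace ℝ (Fin n)}
    (hx : x ∈ S) (hy : y ∈ S) (hxy : dist y x < r) :
    ‖Φ x (y - x)‖ ≤ 11 / 100 * ‖y - x‖ := by
  obtain ⟨T, hT⟩ := hpatch x hx
  have h1 := patch_normal_bound hα hL hT hy (hxy.trans_le hrR)
  have h2 := ContinuousLinearMap.le_of_opNorm_le _ (hΦ.2.2.2 x hx T hT) (y - x)
  rw [ContinuousLinearMap.sub_apply] at h2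
  have h3 : L * ‖y - x‖ ^ α ≤ 1 / 10 := by
    refine le_trans ?_ hr
    rw [dist_eq_norm] at hxy
    gcongr
  have h4 := mul_le_mul_of_nonneg_right h3 (norm_nonneg (y - x))
  have h5 := mul_le_mul_of_nonneg_right hε.le (norm_nonneg (y - x))
  have h6 := norm_le_norm_add_norm_sub' (Φ x (y - x)) (projOp Tᗮ (y - x))
  linarith

/-- The key near-orthogonality estimate. -/
theorem tub_local {m n : ℕ} {R L α ε r δ : ℝ} {K : ℝ≥0} {S : Set (EuclideanSpace ℝ (Fin n))}
    {Φ : EuclideanSpace ℝ (Fin n) → (EuclideanSpace ℝ (Fin n) →L[ℝ] EuclideanSpace ℝ (Fin n))}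
    (hα : 0 < α) (hL : 0 < L)
    (hpatch : ∀ x ∈ S, ∃ T, IsGraphPatchAt m n R L α S x T)
    (hΦ : IsNormalMap m n R L α ε S Φ K) (hε : ε < 1 / 100)
    (hrR : r ≤ R) (hr : L * r ^ α ≤ 1 / 10) (hKδ : K * δ ≤ 1 / 100)
    {x y u v : EuclideanSpace ℝ (Fin n)}
    (hx : x ∈ S) (hy : y ∈ S) (hxy : dist y x < r) (hu : Φ x u = u) (hv : Φ y v = v)
    (hvδ : ‖v‖ ≤ δ) :
    1 / 4 * (dist x y ^ 2 + dist u v ^ 2) ≤ dist (x + u) (y + v) ^ 2 := by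
  have hN := tub_normal hα hL hpatch hΦ hε hrR hr hx hy hxy
  obtain ⟨W, -, hW⟩ := hΦ.2.2.1 x hx
  have hlip : ‖Φ y - Φ x‖ ≤ K * ‖y - x‖ := by
    simpa [dist_eq_norm] using hΦ.2.1.dist_le_mul y hy x hx
  have hd := ContinuousLinearMap.le_of_opNorm_le _ hlip v
  rw [ContinuousLinearMap.sub_apply, hv] at hd
  have hd2 : ‖v - Φ x v‖ ≤ 1 / 100 * ‖y - x‖ := by
    have h1 : (K : ℝ) * ‖y - x‖ * ‖v‖ ≤ K * ‖y - x‖ * δ := by gcongr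
    have h2 := mul_le_mul_of_nonneg_right hKδ (norm_nonneg (y - x))
    linarith
  have hin : inner ℝ (y - x) (v - u) = inner ℝ (Φ x (y - x)) (v - u)
      + inner ℝ (y - x) (v - Φ x v) := by
    rw [hW, projOp_inner, ← hW, map_sub, hu, ← inner_add_right]
    congr 1; abel
  have key := local_lower (y - x) (v - u) (by
    rw [hin]
    refine (abs_add_le _ _).trans ?_
    have h1 := abs_real_inner_le_norm (Φ x (y - x)) (v - u)
    have h2 := abs_real_inner_le_norm (y - x) (v - Φ x v)
    have h3 := mul_le_mul_of_nonneg_right hN (norm_nonneg (v - u))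
    have h4 := mul_le_mul_of_nonneg_left hd2 (norm_nonneg (y - x))
    nlinarith)
  rw [dist_comm x y, dist_comm u v, dist_comm (x + u), dist_eq_norm, dist_eq_norm, dist_eq_norm]
  have e : y + v - (x + u) = (y - x) + (v - u) := by abel
  rw [e]; exact key

/-- **Tubular neighbourhoods for `C^{1,α}` manifolds** (Lemma 4.4): for
`Σ ∈ C^{1,α}_{m,n}(R,L,d)` with an `ε`-normal map `Φ`, there is
`δ_tub = δ_tub(R,L,α,ε,lip Φ) > 0` such that for every `δ ∈ (0,δ_tub]` the map
`Ψ_δ[Σ,Φ](x,v) = x + v` is a `C¹` embedding of `N_δ(Σ,Φ)`, bilipschitz with constants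
`1/4` and `√2`, with `dist(Ψ(x,v),Σ) > |v|/4` for `v ≠ 0` and
`Σ + B(0,δ/2) ⊆ Ψ(N_δ(Σ,Φ))`. -/
theorem tubular_neighbourhood (m n : ℕ) (R L α ε : ℝ) (K : ℝ≥0)
    (hm : 1 ≤ m) (hmn : m < n) (hR : 0 < R) (hL : 0 < L) (hα : 0 < α) (hα1 : α ≤ 1)
    (hε0 : 0 < ε) (hε : ε < 1 / 100) :
    ∃ δtub : ℝ, 0 < δtub ∧ ∀ d : ℝ, 0 < d → ∀ S : Set (EuclideanSpace ℝ (Fin n)),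
      InClassC1 m n R L d α S →
      ∀ Φ : EuclideanSpace ℝ (Fin n) →
          (EuclideanSpace ℝ (Fin n) →L[ℝ] EuclideanSpace ℝ (Fin n)),
        IsNormalMap m n R L α ε S Φ K →
        ∀ δ : ℝ, 0 < δ → δ ≤ δtub → IsTubularRadius S Φ δ := by
  obtain ⟨r, hr0, hrR, hr⟩ : ∃ r : ℝ, 0 < r ∧ r ≤ R ∧ L * r ^ α ≤ 1 / 10 := by
    have hp : 0 < 1 / (10 * L) := by positivity
    refine ⟨min R ((1 / (10 * L)) ^ (1 / α)), lt_min hR (by positivity), min_le_left _ _, ?_⟩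
    have h1 : (min R ((1 / (10 * L)) ^ (1 / α))) ^ α ≤ ((1 / (10 * L)) ^ (1 / α)) ^ α := by
      refine Real.rpow_le_rpow (le_min hR.le (by positivity)) (min_le_right _ _) hα.le
    rw [← Real.rpow_mul hp.le, one_div_mul_cancel hα.ne', Real.rpow_one] at h1
    calc _ ≤ L * (1 / (10 * L)) := by gcongr
      _ = 1 / 10 := by field_simp
  refine ⟨min (r / 16) (1 / (100 * (K + 1))), by positivity, ?_⟩
  intro d hd S hS Φ hΦ δ hδ hδt
  obtain ⟨hne, hcpt, -, hpatch⟩ := hS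
  have hδr : δ ≤ r / 16 := hδt.trans (min_le_left _ _)
  have hKδ : K * δ ≤ 1 / 100 := by
    have h1 : δ ≤ 1 / (100 * (K + 1)) := hδt.trans (min_le_right _ _)
    rw [le_div_iff₀ (by positivity)] at h1
    linarith
  have low : ∀ p ∈ normalNbhd S Φ δ, ∀ q ∈ normalNbhd S Φ δ,
      (1 / 4) * Real.sqrt (dist p.1 q.1 ^ 2 + dist p.2 q.2 ^ 2)
        ≤ dist (p.1 + p.2) (q.1 + q.2) := by
    rintro ⟨x, u⟩ ⟨hx, hu, hun⟩ ⟨y, v⟩ ⟨hy, hv, hvn⟩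
    dsimp only at *
    have key : 1 / 4 * (dist x y ^ 2 + dist u v ^ 2) ≤ dist (x + u) (y + v) ^ 2 := by
      rcases lt_or_ge (dist y x) r with h | h
      · exact tub_local hα hL hpatch hΦ hε hrR hr hKδ hx hy h hu hv hvn.le
      · rw [dist_comm] at h
        have h1 : dist u v ≤ r / 8 := by
          rw [dist_eq_norm]; linarith [norm_sub_le u v]
        have h2 : dist x y ≤ dist (x + u) (y + v) + dist u v := by
          simp only [dist_eq_norm]
          have e : x - y = (x + u - (y + v)) - (u - v) := by abel
          rw [e]; exact norm_sub_le _ _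
        have h3 : 7 / 8 * dist x y ≤ dist (x + u) (y + v) := by linarith
        have h4 : dist u v ≤ 1 / 8 * dist x y := by linarith
        have h5 := dist_nonneg (x := u) (y := v)
        have h6 := dist_nonneg (x := x) (y := y)
        nlinarith
    have hs : Real.sqrt (dist x y ^ 2 + dist u v ^ 2) ≤ 4 * dist (x + u) (y + v) := by
      rw [Real.sqrt_le_left (by positivity)]
      nlinarith [sq_nonneg (dist (x + u) (y + v))]
    linarith
  refine ⟨?_, fun p hp q hq => ⟨low p hp q hq, ?_⟩, ?_, ?_⟩
  · have ha : AntilipschitzWith 4 ((normalNbhd S Φ δ).restrict fun p => p.1 + p.2) := by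
      refine AntilipschitzWith.of_le_mul_dist ?_
      rintro ⟨p, hp⟩ ⟨q, hq⟩
      have h1 := low p hp q hq
      have h2 : dist p q ≤ Real.sqrt (dist p.1 q.1 ^ 2 + dist p.2 q.2 ^ 2) := by
        rw [Prod.dist_eq]
        refine max_le (Real.le_sqrt_of_sq_le ?_) (Real.le_sqrt_of_sq_le ?_)
        · nlinarith [sq_nonneg (dist p.2 q.2)]
        · nlinarith [sq_nonneg (dist p.1 q.1)]
      change dist p q ≤ 4 * dist (p.1 + p.2) (q.1 + q.2)
      linarith
    refine (ha.isUniformEmbedding ?_).isEmbedding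
    have : UniformContinuous fun p : EuclideanSpace ℝ (Fin n) × EuclideanSpace ℝ (Fin n) =>
      p.1 + p.2 := uniformContinuous_add
    exact this.comp uniformContinuous_subtype_val
  · rw [← Real.sqrt_mul (by norm_num)]
    refine Real.le_sqrt_of_sq_le ?_
    have h1 := dist_add_add_le p.1 p.2 q.1 q.2
    have h2 := dist_nonneg (x := p.1 + p.2) (y := q.1 + q.2)
    nlinarith [sq_nonneg (dist p.1 q.1 - dist p.2 q.2)]
  · intro p hp hp2
    obtain ⟨y, hy, hye⟩ := hcpt.exists_infDist_eq_dist hne (p.1 + p.2)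
    rw [hye]
    have hpos : 0 < ‖p.2‖ := norm_pos_iff.2 hp2
    have h1 := low p hp (y, 0) ⟨hy, by simp, by simpa using hδ⟩
    simp only [dist_zero_right, add_zero] at h1
    rcases eq_or_ne p.1 y with h | h
    · rw [h, dist_eq_norm, add_sub_cancel_left]; linarith
    · have hd0 : 0 < dist p.1 y := dist_pos.2 h
      have : ‖p.2‖ < Real.sqrt (dist p.1 y ^ 2 + ‖p.2‖ ^ 2) := by
        refine Real.lt_sqrt_of_sq_lt ?_
        nlinarith
      linarith
  · rintro z ⟨s, hs, hz⟩
    obtain ⟨T, hT⟩ := hpatch s hs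
    obtain ⟨x, hx, hxs, hxz⟩ := tub_surj hΦ hε0 hε hδ (by linarith) hKδ hT hs hz
    refine ⟨(x, z - x), ⟨hx, hxz, ?_⟩, by simp⟩
    have h1 := tub_local (u := z - x) (v := 0) hα hL hpatch hΦ hε hrR hr hKδ hx hs
      (by rw [dist_comm]; linarith) hxz (by simp) (by simpa using hδ.le)
    simp only [dist_zero_right, add_zero, add_sub_cancel] at h1
    change ‖z - x‖ < δ
    have h2 := dist_nonneg (x := z) (y := s)
    nlinarith [sq_nonneg (dist x s), norm_nonneg (z - x)]
end
end
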